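/- arXiv:1706.06467 — 5 statements merged into one kernel-verified Lean document; each statement's English description precedes it below -/
import Mathlib

section
/- Let A be an m×n matrix with entries in {0,1}, m ≥ 2, such that R := max_{1≤i≤m} ( max_{1≤j≤n}(A_{ij} − A_{1j}) − min_{1≤j≤n}(A_{ij} − A_{1j}) ) equals 1. For k ∈ {1,…,m} set C⁻(k) := 2^{(k−m)/2} · κ_{m−k} · k^{2−k}, for j ∈ {0,…,m} set C⁺(j) := 2^m · 3^{m+n−2} · (2√(m−1))^{j−1}, and let ε̄ := min_{1≤k≤m} C⁻(k)/C⁺(k−1). Fix a real ε with 0 < ε < min(ε̄, 1) and k ∈ {1,…,m}. Then the tropical rank of A equals k if and only if C⁻(k)·ε^{m−k} ≤ Vol(tconv(A) + B_H(ε)) ≤ C⁺(k)·ε^{m−k}, where Vol denotes Lebesgue measure on ℝ^{m−1}. -/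
open MeasureTheory Pointwise

noncomputable section

/-- Hilbert ball of radius `δ` in `ℝ^n` (chart coordinates). -/
def hilbertBall (n : ℕ) (δ : ℝ) : Set (Fin n → ℝ) :=
  {y | max 0 (⨆ i, y i) - min 0 (⨅ i, y i) ≤ δ}

/-- Tropical (min-plus) convex hull of the columns of a matrix `A`, viewed in the chart
`x ↦ (x_2 − x_1, …, x_m − x_1)`, i.e. as a subset of `ℝ^(m-1)`. -/
def tconv (m : ℕ) {ι : Type*} (A : Fin m → ι → ℝ) : Set (Fin (m - 1) → ℝ) :=
  {y | ∃ α : ι → ℝ, ∀ k : Fin (m - 1),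
      y k = (⨅ j, (α j + A ⟨(k : ℕ) + 1, by have := k.isLt; omega⟩ j))
          - (⨅ j, (α j + A ⟨0, by have := k.isLt; omega⟩ j))}

/-- A square matrix is tropically nonsingular if the minimum over permutations `σ` of
`∑ i, M i (σ i)` is attained by exactly one permutation. -/
def TropNonsingular {k : ℕ} (M : Fin k → Fin k → ℝ) : Prop :=
  ∃! σ : Equiv.Perm (Fin k), ∀ τ : Equiv.Perm (Fin k),
    ∑ i, M i (σ i) ≤ ∑ i, M i (τ i)

/-- The tropical rank of `A`: the largest `k` such that `A` has a tropically
nonsingular `k × k` submatrix. -/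
def tropRank (m n : ℕ) (A : Fin m → Fin n → ℝ) : ℕ :=
  sSup {k : ℕ | ∃ r : Fin k → Fin m, ∃ c : Fin k → Fin n,
    Function.Injective r ∧ Function.Injective c ∧
    TropNonsingular (fun i j => A (r i) (c j))}


/-- `kappa d` is the Lebesgue volume of the `d`-dimensional Euclidean unit ball,
`π^(d/2) / Γ(d/2 + 1)`. -/
def kappa (d : ℕ) : ℝ := Real.pi ^ ((d : ℝ) / 2) / Real.Gamma ((d : ℝ) / 2 + 1)

/-- The change of affine chart that makes the `i`-th coordinate the new base point. -/
def rebase {ι : Type*} [DecidableEq ι] (i : ι) : (ι → ℝ) →ₗ[ℝ] (ι → ℝ) where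
  toFun y j := if j = i then -y i else y j - y i
  map_add' x y := by
    ext j
    by_cases h : j = i
    · simp [h]
      ring
    · simp [h]
      ring
  map_smul' c x := by
    ext j
    by_cases h : j = i
    · simp [h]
    · simp [h]
      ring

lemma rebase_apply {ι : Type*} [DecidableEq ι] (i j : ι) (y : ι → ℝ) :
    rebase i y j = if j = i then -y i else y j - y i := rfl

lemma rebase_comp_self {ι : Type*} [DecidableEq ι] (i : ι) :
    rebase i ∘ₗ rebase i = LinearMap.id := by
  refine LinearMap.ext fun y => funext fun j => ?_
  by_cases h : j = i <;> simp [h, rebase_apply]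

lemma volume_preimage_rebase {ι : Type*} [Fintype ι] [DecidableEq ι] (i : ι)
    (S : Set (ι → ℝ)) : volume (rebase i ⁻¹' S) = volume S := by
  have h := congrArg LinearMap.det (rebase_comp_self i)
  rw [LinearMap.det_comp, LinearMap.det_id] at h
  have h1 : |LinearMap.det (rebase i)| = 1 := by
    rcases mul_self_eq_one_iff.mp h with h | h <;> simp [h]
  have h0 : LinearMap.det (rebase i) ≠ 0 := by
    intro h0
    simp [h0] at h1
  rw [Measure.addHaar_preimage_linearMap _ h0, abs_inv, h1]
  simp

/-- A shear of a product set over a measurable graph has the volume of the product. -/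
lemma volume_shear {ι : Type*} [Fintype ι] (p : ι → Prop) [DecidablePred p]
    {P : Set ({i // p i} → ℝ)} {B : Set ({i // ¬ p i} → ℝ)}
    (hP : MeasurableSet P) (hB : MeasurableSet B)
    {g : ({i // p i} → ℝ) → ({i // ¬ p i} → ℝ)} (hg : Measurable g) :
    volume {y : ι → ℝ | (fun i : {i // p i} => y i) ∈ P ∧
        (fun i : {i // ¬ p i} => y i) - g (fun i : {i // p i} => y i) ∈ B} =
      volume P * volume B := by
  have hmp := volume_preserving_piEquivPiSubtypeProd (fun _ : ι => ℝ) p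
  set T : Set (({i // p i} → ℝ) × ({i // ¬ p i} → ℝ)) := {z | z.1 ∈ P ∧ z.2 - g z.1 ∈ B}
  have hT : MeasurableSet T :=
    (measurable_fst hP).inter
      ((measurable_snd.sub (hg.comp measurable_fst)) hB)
  have hpre : {y : ι → ℝ | (fun i : {i // p i} => y i) ∈ P ∧
        (fun i : {i // ¬ p i} => y i) - g (fun i : {i // p i} => y i) ∈ B} =
      MeasurableEquiv.piEquivPiSubtypeProd (fun _ : ι => ℝ) p ⁻¹' T := rfl
  rw [hpre, hmp.measure_preimage hT.nullMeasurableSet, Measure.volume_eq_prod,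
    Measure.prod_apply hT]
  have hfib : ∀ x, volume (Prod.mk x ⁻¹' T) = P.indicator (fun _ => volume B) x := by
    intro x
    by_cases hx : x ∈ P
    · have : Prod.mk x ⁻¹' T = (fun v => v - g x) ⁻¹' B := by
        ext v
        simp [T, hx]
      rw [this, Set.indicator_of_mem hx, show (fun v => v - g x) = fun v => v + -g x from
        funext fun v => sub_eq_add_neg v _, measure_preimage_add_right]
    · have : Prod.mk x ⁻¹' T = ∅ := by
        ext v
        simp [T, hx]
      rw [this, Set.indicator_of_notMem hx, measure_empty]
  simp_rw [hfib]
  rw [lintegral_indicator_const hP, mul_comm]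

/-- Lower bound for the volume of a Hilbert ball of radius `δ`. -/
lemma le_volume_hilbert {ι : Type*} [Fintype ι] {δ : ℝ} :
    ((Fintype.card ι : ENNReal) + 1) * ENNReal.ofReal δ ^ Fintype.card ι ≤
      volume {y : ι → ℝ | (∀ i, |y i| ≤ δ) ∧ ∀ i j, y i - y j ≤ δ} := by
  classical
  set C : Set (ι → ℝ) := Set.univ.pi fun _ => Set.Ioc 0 δ
  have hC : MeasurableSet C := MeasurableSet.univ_pi fun _ => measurableSet_Ioc
  have hvC : volume C = ENNReal.ofReal δ ^ Fintype.card ι := by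
    simp [C, Real.volume_pi_Ioc, Finset.prod_const]
  let F : Option ι → Set (ι → ℝ) := fun o => o.elim C fun i => rebase i ⁻¹' C
  have hF : ∀ o, MeasurableSet (F o) := by
    rintro (_ | i)
    · exact hC
    · exact (LinearMap.continuous_of_finiteDimensional (rebase i)).measurable hC
  have hvF : ∀ o, volume (F o) = ENNReal.ofReal δ ^ Fintype.card ι := by
    rintro (_ | i)
    · exact hvC
    · exact (volume_preimage_rebase i C).trans hvC
  have hnone : ∀ y, y ∈ F none ↔ ∀ i, 0 < y i ∧ y i ≤ δ := by
    intro y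
    simp [F, C, Set.mem_pi]
  have hsome : ∀ y i, y ∈ F (some i) ↔
      (0 < -y i ∧ -y i ≤ δ) ∧ ∀ j, j ≠ i → 0 < y j - y i ∧ y j - y i ≤ δ := by
    intro y i
    simp only [F, C, Option.elim, Set.mem_preimage, Set.mem_pi, Set.mem_univ, true_imp_iff,
      Set.mem_Ioc, rebase_apply]
    constructor
    · intro h
      exact ⟨by simpa using h i, fun j hj => by simpa [hj] using h j⟩
    · rintro ⟨h1, h2⟩ j
      by_cases hj : j = i
      · simpa [hj] using h1
      · simpa [hj] using h2 j hj
  have hdisj : Pairwise (Function.onFun Disjoint F) := by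
    rintro (_ | i) (_ | j) hij
    · exact absurd rfl hij
    · refine Set.disjoint_left.2 fun y h1 h2 => ?_
      have := ((hnone y).1 h1 j).1
      have := ((hsome y j).1 h2).1.1
      linarith
    · refine Set.disjoint_left.2 fun y h2 h1 => ?_
      have := ((hnone y).1 h1 i).1
      have := ((hsome y i).1 h2).1.1
      linarith
    · have hne : i ≠ j := fun h => hij (congrArg some h)
      refine Set.disjoint_left.2 fun y h1 h2 => ?_
      have := (((hsome y i).1 h1).2 j hne.symm).1
      have := (((hsome y j).1 h2).2 i hne).1
      linarith
  have hsub : (⋃ o, F o) ⊆ {y : ι → ℝ | (∀ i, |y i| ≤ δ) ∧ ∀ i j, y i - y j ≤ δ} := by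
    refine Set.iUnion_subset ?_
    rintro (_ | l) y hy
    · have h := (hnone y).1 hy
      exact ⟨fun i => abs_le.2 ⟨by linarith [h i], (h i).2⟩, fun i j => by linarith [h i, h j]⟩
    · obtain ⟨h1, h2⟩ := (hsome y l).1 hy
      have h3 : ∀ j, 0 ≤ y j - y l ∧ y j - y l ≤ δ := by
        intro j
        by_cases hj : j = l
        · subst hj
          constructor <;> linarith
        · exact ⟨(h2 j hj).1.le, (h2 j hj).2⟩
      exact ⟨fun i => abs_le.2 ⟨by linarith [h3 i], by linarith [h3 i]⟩,
        fun i j => by linarith [h3 i, h3 j]⟩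
  calc ((Fintype.card ι : ENNReal) + 1) * ENNReal.ofReal δ ^ Fintype.card ι
      = volume (⋃ o, F o) := by
        rw [measure_iUnion hdisj hF, tsum_fintype]
        simp [hvF, add_mul]
    _ ≤ _ := measure_mono hsub


lemma volume_sum_sq_le {ι : Type*} [Fintype ι] {ρ : ℝ} (hρ : 0 ≤ ρ) :
    volume {v : ι → ℝ | ∑ i, v i ^ 2 ≤ ρ ^ 2} =
      ENNReal.ofReal (kappa (Fintype.card ι) * ρ ^ Fintype.card ι) := by
  have hpi : Real.pi ^ ((Fintype.card ι : ℝ) / 2) = √Real.pi ^ Fintype.card ι := by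
    rw [Real.sqrt_eq_rpow, ← Real.rpow_natCast, ← Real.rpow_mul Real.pi_pos.le]
    ring_nf
  cases isEmpty_or_nonempty ι with
  | inl h =>
    have : {v : ι → ℝ | ∑ i, v i ^ 2 ≤ ρ ^ 2} = Set.univ := by
      ext v
      simp [sq_nonneg]
    rw [this]
    simp [kappa, volume_pi]
  | inr h =>
    have h1 := (PiLp.volume_preserving_ofLp ι).measure_preimage_emb
      (MeasurableEquiv.toLp 2 (ι → ℝ)).symm.measurableEmbedding
      {v : ι → ℝ | ∑ i, v i ^ 2 ≤ ρ ^ 2}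
    rw [← h1]
    have h2 : (WithLp.ofLp ⁻¹' {v : ι → ℝ | ∑ i, v i ^ 2 ≤ ρ ^ 2} : Set (EuclideanSpace ℝ ι)) =
        Metric.closedBall 0 ρ := by
      ext v
      simp only [Set.mem_preimage, Set.mem_ofPred_eq, mem_closedBall_zero_iff,
        EuclideanSpace.norm_eq, Real.norm_eq_abs, sq_abs]
      rw [Real.sqrt_le_left hρ]
    rw [h2, EuclideanSpace.volume_closedBall, ← ENNReal.ofReal_pow hρ,
      ← ENNReal.ofReal_mul (by positivity), kappa, hpi, mul_comm]

/-- If every permutation has nonnegative weight, so has every closed walk. -/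
lemma closed_walk_nonneg {V : Type*} [Fintype V] [DecidableEq V] {w : V → V → ℝ}
    (hdiag : ∀ i, w i i = 0) (hperm : ∀ τ : Equiv.Perm V, 0 ≤ ∑ i, w i (τ i))
    {n : ℕ} (v : ℕ → V) (hv : v n = v 0) :
    0 ≤ ∑ t ∈ Finset.range n, w (v t) (v (t + 1)) := by
  rcases Nat.eq_zero_or_pos n with rfl | hn
  · simp
  have hn' : (0 : ℝ) < n := by exact_mod_cast hn
  let L : Matrix V V ℝ →ₗ[ℝ] ℝ :=
    { toFun := fun D => ∑ i, ∑ j, D i j * w i j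
      map_add' := fun D E => by simp [add_mul, Finset.sum_add_distrib]
      map_smul' := fun c D => by simp [Finset.mul_sum, mul_assoc] }
  have hL : ∀ D ∈ doublyStochastic ℝ V, 0 ≤ L D := by
    intro D hD
    have hD' : D ∈ convexHull ℝ {σ.permMatrix ℝ | σ : Equiv.Perm V} := by
      rw [← doublyStochastic_eq_convexHull_permMatrix]
      exact hD
    refine convexHull_min (t := {D | 0 ≤ L D}) ?_ (convex_halfSpace_ge L.isLinear 0) hD'
    rintro _ ⟨σ, rfl⟩
    have : L (σ.permMatrix ℝ) = ∑ i, w i (σ i) := by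
      simp [L, Equiv.Perm.permMatrix, PEquiv.toMatrix_apply, ite_mul]
    simpa [this] using hperm σ
  let e : V → V → Matrix V V ℝ := fun a b => Matrix.single a b 1
  let D : Matrix V V ℝ := ∑ t ∈ Finset.range n, (n : ℝ)⁻¹ •
    (1 - e (v t) (v t) + e (v t) (v (t + 1)))
  have hDd : D ∈ doublyStochastic ℝ V := by
    rw [mem_doublyStochastic_iff_sum]
    refine ⟨fun i j => ?_, fun i => ?_, fun j => ?_⟩
    · simp only [D, Matrix.sum_apply, Matrix.smul_apply, Matrix.add_apply, Matrix.sub_apply]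
      refine Finset.sum_nonneg fun t _ => ?_
      simp only [e, Matrix.single_apply, Matrix.one_apply, smul_eq_mul]
      refine mul_nonneg (by positivity) ?_
      split_ifs <;> grind
    · simp only [D, Matrix.sum_apply, Matrix.smul_apply, Matrix.add_apply, Matrix.sub_apply]
      rw [Finset.sum_comm]
      simp only [e, Matrix.single_apply, Matrix.one_apply, smul_eq_mul, ← Finset.mul_sum,
        Finset.sum_add_distrib, Finset.sum_sub_distrib]
      simp [ite_and, hn'.ne']
    · simp only [D, Matrix.sum_apply, Matrix.smul_apply, Matrix.add_apply, Matrix.sub_apply]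
      rw [Finset.sum_comm]
      simp only [e, Matrix.single_apply, Matrix.one_apply, smul_eq_mul, ← Finset.mul_sum,
        Finset.sum_add_distrib, Finset.sum_sub_distrib]
      have := Finset.sum_range_sub (fun t => if v t = j then (1 : ℝ) else 0) n
      simp only [hv, sub_self, Finset.sum_sub_distrib] at this
      simp only [ite_and, Finset.sum_ite_eq, Finset.sum_ite_eq', Finset.mem_univ, if_true]
      simp
      rw [inv_mul_eq_div, div_eq_one_iff_eq hn'.ne']
      simp at this
      linarith
  have h := hL D hDd
  have hsingle : ∀ a b, L (e a b) = w a b := by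
    intro a b
    simp [L, e, Matrix.single_apply, ite_and, ite_mul]
  have hone : L 1 = 0 := by
    simp [L, Matrix.one_apply, hdiag]
  simp only [D, map_sum, map_smul, map_add, map_sub, hsingle, hone, hdiag, smul_eq_mul,
    ← Finset.mul_sum] at h
  simpa [hn'] using h

/-- Existence of potentials for a weight function without negative permutations. -/
lemma exists_potential {V : Type*} [Fintype V] [DecidableEq V] [Nonempty V] {w : V → V → ℝ}
    (hdiag : ∀ i, w i i = 0) (hperm : ∀ τ : Equiv.Perm V, 0 ≤ ∑ i, w i (τ i)) :
    ∃ x : V → ℝ, ∀ i j, x i - x j ≤ w i j := by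
  obtain ⟨z⟩ := ‹Nonempty V›
  let W : V → Set ℝ := fun i => {s | ∃ (n : ℕ) (v : ℕ → V), v 0 = i ∧ v n = z ∧
    s = ∑ t ∈ Finset.range n, w (v t) (v (t + 1))}
  have hcons : ∀ i j, ∀ s ∈ W j, w i j + s ∈ W i := by
    rintro i j s ⟨n, v, h0, hz, rfl⟩
    refine ⟨n + 1, fun t => Nat.casesOn t i v, rfl, hz, ?_⟩
    rw [Finset.sum_range_succ', add_comm]
    simp [h0]
  have hbdd : ∀ i, BddBelow (W i) := by
    intro i
    refine ⟨-w z i, fun s hs => ?_⟩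
    obtain ⟨n, v, h0, hz, h⟩ := hcons z i s hs
    have := closed_walk_nonneg hdiag hperm v (hz.trans h0.symm)
    linarith
  have hne : ∀ i, (W i).Nonempty := by
    intro i
    exact ⟨_, hcons i z 0 ⟨0, fun _ => z, rfl, rfl, by simp⟩⟩
  refine ⟨fun i => sInf (W i), fun i j => ?_⟩
  have : sInf (W i) - w i j ≤ sInf (W j) :=
    le_csInf (hne j) fun s hs => by linarith [csInf_le (hbdd i) (hcons i j s hs)]
  linarith

/-- The row `i` is tight at the column `j` for the point `x`. -/
def TightAt {ι κ : Type*} (A : ι → κ → ℝ) (x : ι → ℝ) (i : ι) (j : κ) : Prop :=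
  ∀ l, x l - A l j ≤ x i - A i j

lemma tropNonsingular_of_potential {k : ℕ} {M : Fin k → Fin k → ℝ} {u v : Fin k → ℝ}
    (heq : ∀ a, M a a = u a + v a) (hlt : ∀ a b, a ≠ b → u a + v b < M a b) :
    TropNonsingular M := by
  have hle : ∀ a b, u a + v b ≤ M a b := by
    intro a b
    by_cases h : a = b
    · exact h ▸ (heq a).ge
    · exact (hlt a b h).le
  have hsum : ∀ τ : Equiv.Perm (Fin k), ∑ i, (u i + v (τ i)) = ∑ i, M i i := by
    intro τ
    rw [Finset.sum_add_distrib, Equiv.sum_comp τ v, ← Finset.sum_add_distrib]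
    exact Finset.sum_congr rfl fun i _ => (heq i).symm
  refine ⟨1, fun τ => ?_, fun σ hσ => ?_⟩
  · simp only [Equiv.Perm.one_apply]
    rw [← hsum τ]
    exact Finset.sum_le_sum fun i _ => hle i _
  · by_contra hne
    obtain ⟨i, hi⟩ : ∃ i, σ i ≠ i := by
      by_contra! h
      exact hne (Equiv.ext h)
    have h1 := hσ 1
    simp only [Equiv.Perm.one_apply] at h1
    rw [← hsum σ] at h1
    exact absurd h1 (not_le.2 (Finset.sum_lt_sum (fun i _ => hle i _)
      ⟨i, Finset.mem_univ _, hlt i _ (Ne.symm hi)⟩))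

lemma bddAbove_nonsingular_sizes (m n : ℕ) (A : Fin m → Fin n → ℝ) :
    BddAbove {k : ℕ | ∃ r : Fin k → Fin m, ∃ c : Fin k → Fin n,
      Function.Injective r ∧ Function.Injective c ∧
      TropNonsingular (fun i j => A (r i) (c j))} := by
  refine ⟨m, ?_⟩
  rintro k ⟨r, _, hr, _⟩
  simpa using Fintype.card_le_of_injective r hr

lemma tropRank_spec {m n : ℕ} (A : Fin m → Fin n → ℝ) :
    ∃ r : Fin (tropRank m n A) → Fin m, ∃ c : Fin (tropRank m n A) → Fin n,
      Function.Injective r ∧ Function.Injective c ∧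
      TropNonsingular (fun i j => A (r i) (c j)) := by
  refine Nat.sSup_mem (s := {k : ℕ | ∃ r : Fin k → Fin m, ∃ c : Fin k → Fin n,
    Function.Injective r ∧ Function.Injective c ∧
    TropNonsingular (fun i j => A (r i) (c j))}) ⟨0, finZeroElim, finZeroElim,
      fun a => a.elim0, fun a => a.elim0, 1, fun τ => ?_, fun σ _ => Subsingleton.elim _ _⟩
    (bddAbove_nonsingular_sizes m n A)
  simp

lemma tropRank_le_left {m n : ℕ} (A : Fin m → Fin n → ℝ) : tropRank m n A ≤ m := by
  obtain ⟨r, _, hr, _⟩ := tropRank_spec A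
  simpa using Fintype.card_le_of_injective r hr

lemma one_le_tropRank {m n : ℕ} (hm : 0 < m) (hn : 0 < n) (A : Fin m → Fin n → ℝ) :
    1 ≤ tropRank m n A :=
  le_csSup (bddAbove_nonsingular_sizes m n A)
    ⟨fun _ => ⟨0, hm⟩, fun _ => ⟨0, hn⟩, Function.injective_of_subsingleton _,
      Function.injective_of_subsingleton _, 1, fun τ => by simp,
      fun σ _ => Subsingleton.elim _ _⟩

/-- Every point has at most `tropRank` many rows that are tight at all columns. -/
lemma exists_tight_rows {m n : ℕ} (hm : 0 < m) (A : Fin m → Fin n → ℝ)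
    (x : Fin m → ℝ) :
    ∃ s : Finset (Fin m), s.card = tropRank m n A ∧ ∀ j, ∃ a ∈ s, TightAt A x a j := by
  classical
  have : Nonempty (Fin m) := ⟨⟨0, hm⟩⟩
  have huniv : ∀ j, ∃ a ∈ Finset.univ, TightAt A x a j := by
    intro j
    obtain ⟨a, ha⟩ := Finite.exists_max fun i => x i - A i j
    exact ⟨a, Finset.mem_univ _, ha⟩
  obtain ⟨s, -, hs⟩ := exists_minimal_le_of_wellFoundedLT
    (fun s : Finset (Fin m) => ∀ j, ∃ a ∈ s, TightAt A x a j) Finset.univ huniv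
  have hpriv : ∀ a : s, ∃ j, ∀ b ∈ s, TightAt A x b j → b = a := by
    rintro ⟨a, ha⟩
    by_contra! h
    have h1 : ∀ j, ∃ b ∈ s.erase a, TightAt A x b j := by
      intro j
      obtain ⟨b, hb, ht, hne⟩ := h j
      exact ⟨b, Finset.mem_erase.2 ⟨hne, hb⟩, ht⟩
    exact Finset.notMem_erase a s (hs.2 h1 (Finset.erase_subset _ _) ha)
  choose c hc using hpriv
  have htight : ∀ a : s, TightAt A x a (c a) := by
    intro a
    obtain ⟨b, hb, ht⟩ := hs.1 (c a)
    exact hc a b hb ht ▸ ht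
  have hstrict : ∀ a b : s, a ≠ b → x a - A a (c b) < x b - A b (c b) := by
    intro a b hab
    refine lt_of_le_of_ne (htight b a) fun h => hab (Subtype.ext (hc b a a.2 fun l => ?_))
    rw [h]
    exact htight b l
  have hinj : Function.Injective c := by
    intro a b hab
    by_contra hne
    have := hstrict a b hne
    have := hab ▸ htight a b
    linarith
  have hcard : s.card ≤ tropRank m n A := by
    let e := s.equivFin.symm
    refine le_csSup (bddAbove_nonsingular_sizes m n A) ⟨fun i => e i, fun i => c (e i),
      Subtype.val_injective.comp e.injective, hinj.comp e.injective,
      tropNonsingular_of_potential (u := fun i => x (e i))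
        (v := fun i => A (e i) (c (e i)) - x (e i)) (fun a => by ring) fun a b hab => ?_⟩
    linarith [hstrict (e a) (e b) fun h => hab (e.injective h)]
  obtain ⟨t, hst, -, ht⟩ := Finset.exists_subsuperset_card_eq (Finset.subset_univ s) hcard
    (by simpa using tropRank_le_left A)
  refine ⟨t, ht, fun j => ?_⟩
  obtain ⟨a, ha, h⟩ := hs.1 j
  exact ⟨a, hst ha, h⟩

/-- A tropically nonsingular integer matrix admits potentials with slack `1 / k`. -/
lemma TropNonsingular.exists_potential {k : ℕ} (hk : 0 < k) {M : Fin k → Fin k → ℝ}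
    (hM : TropNonsingular M) (hint : ∀ i j, ∃ z : ℤ, M i j = z) :
    ∃ (σ : Equiv.Perm (Fin k)) (x : Fin k → ℝ), ∀ i j, i ≠ j →
      x i - x j ≤ M i (σ j) - M j (σ j) - 1 / k := by
  have : Nonempty (Fin k) := ⟨⟨0, hk⟩⟩
  have hk' : (0 : ℝ) < k := by exact_mod_cast hk
  obtain ⟨σ, hσ, huniq⟩ := hM
  choose Z hZ using hint
  have hgap : ∀ τ : Equiv.Perm (Fin k), τ ≠ σ → ∑ i, M i (σ i) + 1 ≤ ∑ i, M i (τ i) := by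
    intro τ hτ
    have hne : ∑ i, M i (σ i) ≠ ∑ i, M i (τ i) := fun h =>
      hτ (huniq τ fun ρ => h ▸ hσ ρ)
    have hlt := lt_of_le_of_ne (hσ τ) hne
    simp only [hZ] at hlt ⊢
    exact_mod_cast hlt
  let w : Fin k → Fin k → ℝ := fun i j =>
    M i (σ j) - M j (σ j) - if i = j then 0 else 1 / (k : ℝ)
  obtain ⟨x, hx⟩ := _root_.exists_potential (w := w) (fun i => by simp [w]) fun τ => by
    have h1 : ∑ i, M (τ i) (σ (τ i)) = ∑ i, M i (σ i) :=
      Equiv.sum_comp τ fun i => M i (σ i)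
    simp only [w, Finset.sum_sub_distrib, h1]
    by_cases hτ : τ = 1
    · simp [hτ]
    · have h2 := hgap (σ * τ) fun h => hτ (by simpa using h)
      simp only [Equiv.Perm.mul_apply] at h2
      have h3 : ∑ i, (if i = τ i then 0 else 1 / (k : ℝ)) ≤ 1 := by
        calc ∑ i, (if i = τ i then 0 else 1 / (k : ℝ)) ≤ ∑ _i : Fin k, 1 / (k : ℝ) :=
              Finset.sum_le_sum fun i _ => by
                split_ifs
                · positivity
                · exact le_rfl
          _ = 1 := by
              simp [hk'.ne']
      linarith
  refine ⟨σ, x, fun i j hij => ?_⟩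
  have := hx i j
  simpa [w, hij] using this

/-- The representative with vanishing first coordinate of a point of the affine chart. -/
def homLift {d : ℕ} (y : Fin d → ℝ) : Fin (d + 1) → ℝ := Fin.cons (α := fun _ => ℝ) 0 y

@[simp] lemma homLift_zero {d : ℕ} (y : Fin d → ℝ) : homLift y 0 = 0 := rfl

@[simp] lemma homLift_succ {d : ℕ} (y : Fin d → ℝ) (i : Fin d) :
    homLift y i.succ = y i := rfl

lemma homLift_rebase {d : ℕ} (i : Fin d) (y : Fin d → ℝ) (l : Fin (d + 1)) :
    homLift (rebase i y) l = homLift y (Equiv.swap 0 i.succ l) - homLift y i.succ := by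
  refine Fin.cases ?_ (fun j => ?_) l
  · simp
  · by_cases hj : j = i
    · subst hj
      simp [rebase_apply]
    · rw [Equiv.swap_apply_of_ne_of_ne (Fin.succ_ne_zero j)
        fun h => hj (Fin.succ_injective _ h)]
      simp [rebase_apply, hj]

lemma mem_hilbertBall_iff {d : ℕ} {δ : ℝ} {y : Fin d → ℝ} :
    y ∈ hilbertBall d δ ↔ ∀ i j, homLift y i - homLift y j ≤ δ := by
  change max 0 (⨆ i, y i) - min 0 (⨅ i, y i) ≤ δ ↔ _
  constructor
  · intro h i j
    have h1 : homLift y i ≤ max 0 (⨆ i, y i) := by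
      refine Fin.cases (le_max_left _ _) (fun l => ?_) i
      exact (le_ciSup (Set.finite_range y).bddAbove l).trans (le_max_right _ _)
    have h2 : min 0 (⨅ i, y i) ≤ homLift y j := by
      refine Fin.cases (min_le_left _ _) (fun l => ?_) j
      exact (min_le_right _ _).trans (ciInf_le (Set.finite_range y).bddBelow l)
    linarith
  · intro h
    have h1 : ∃ i, max 0 (⨆ i, y i) = homLift y i := by
      cases isEmpty_or_nonempty (Fin d) with
      | inl he => exact ⟨0, by simp⟩
      | inr hne =>
        obtain ⟨l, hl⟩ := exists_eq_ciSup_of_finite (f := y)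
        rcases max_choice 0 (⨆ i, y i) with hm | hm
        · exact ⟨0, hm⟩
        · exact ⟨l.succ, by rw [hm, ← hl]; rfl⟩
    have h2 : ∃ i, min 0 (⨅ i, y i) = homLift y i := by
      cases isEmpty_or_nonempty (Fin d) with
      | inl he => exact ⟨0, by simp⟩
      | inr hne =>
        obtain ⟨l, hl⟩ := exists_eq_ciInf_of_finite (f := y)
        rcases min_choice 0 (⨅ i, y i) with hm | hm
        · exact ⟨0, hm⟩
        · exact ⟨l.succ, by rw [hm, ← hl]; rfl⟩
    obtain ⟨i, hi⟩ := h1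
    obtain ⟨j, hj⟩ := h2
    rw [hi, hj]
    exact h i j

lemma mem_tconv_iff {d n : ℕ} (hn : 0 < n) {A : Fin (d + 1) → Fin n → ℝ} {y : Fin d → ℝ} :
    y ∈ tconv (d + 1) A ↔
      ∃ x : Fin (d + 1) → ℝ, (∀ i, ∃ j, TightAt A x i j) ∧ ∀ i, homLift y i = x i - x 0 := by
  have : Nonempty (Fin n) := ⟨⟨0, hn⟩⟩
  change (∃ α : Fin n → ℝ, ∀ k : Fin d,
      y k = (⨅ j, (α j + A k.succ j)) - ⨅ j, (α j + A 0 j)) ↔ _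
  constructor
  · rintro ⟨α, hα⟩
    refine ⟨fun i => ⨅ j, (α j + A i j), fun i => ?_, fun i => ?_⟩
    · obtain ⟨j, hj⟩ := exists_eq_ciInf_of_finite (f := fun j => α j + A i j)
      refine ⟨j, fun l => ?_⟩
      have := ciInf_le (Set.finite_range fun j => α j + A l j).bddBelow j
      linarith
    · refine Fin.cases (by simp) (fun k => ?_) i
      exact hα k
  · rintro ⟨x, hx, hy⟩
    have key : ∀ i, ⨅ j, ((⨆ l, (x l - A l j)) + A i j) = x i := by
      intro i
      apply le_antisymm
      · obtain ⟨j, hj⟩ := hx i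
        refine (ciInf_le (Set.finite_range _).bddBelow j).trans ?_
        have : ⨆ l, (x l - A l j) ≤ x i - A i j := ciSup_le hj
        linarith
      · refine le_ciInf fun j => ?_
        have := le_ciSup (Set.finite_range fun l => x l - A l j).bddAbove i
        linarith
    refine ⟨fun j => ⨆ l, (x l - A l j), fun k => ?_⟩
    simp only [key]
    exact hy k.succ

/-- The part of the neighbourhood of `tconv A` near points all of whose columns are tight
at one of the rows in `s`. -/
def tropPiece {d n : ℕ} (A : Fin (d + 1) → Fin n → ℝ) (ε : ℝ) (s : Finset (Fin (d + 1))) :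
    Set (Fin d → ℝ) :=
  {y | ∃ x h : Fin (d + 1) → ℝ, (∀ i, ∃ j, TightAt A x i j) ∧
    (∀ j, ∃ a ∈ s, TightAt A x a j) ∧ (∀ i l, h i - h l ≤ ε) ∧
    ∀ i, homLift y i = x i + h i - (x 0 + h 0)}

lemma tropPiece_univ_subset {d n : ℕ} (hn : 0 < n) (A : Fin (d + 1) → Fin n → ℝ) (ε : ℝ) :
    tropPiece A ε Finset.univ ⊆ tconv (d + 1) A + hilbertBall (d + 1 - 1) ε := by
  rintro y ⟨x, h, hx, -, hh, hy⟩
  refine Set.mem_add.2 ⟨fun i => x i.succ - x 0, (mem_tconv_iff hn).2 ⟨x, hx, ?_⟩,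
    fun i => h i.succ - h 0, mem_hilbertBall_iff.2 ?_, ?_⟩
  · exact Fin.cases (by simp) fun i => by simp
  · have : ∀ i, homLift (fun i => h (Fin.succ i) - h 0) i = h i - h 0 :=
      Fin.cases (by simp) fun i => by simp
    intro i j
    rw [this, this]
    linarith [hh i j]
  · ext i
    have := hy i.succ
    simp only [homLift_succ, Pi.add_apply] at this ⊢
    linarith

lemma tconv_add_hilbertBall_subset {d n : ℕ} (hn : 0 < n) (A : Fin (d + 1) → Fin n → ℝ)
    (ε : ℝ) : tconv (d + 1) A + hilbertBall (d + 1 - 1) ε ⊆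
      ⋃ s ∈ Finset.powersetCard (tropRank (d + 1) n A) Finset.univ, tropPiece A ε s := by
  rintro y hy
  obtain ⟨z, hz, h, hh, rfl⟩ := Set.mem_add.1 hy
  obtain ⟨x, hx, hzx⟩ := (mem_tconv_iff hn).1 hz
  obtain ⟨s, hs, hts⟩ := exists_tight_rows d.succ_pos A x
  refine Set.mem_biUnion (Finset.mem_coe.2 (Finset.mem_powersetCard_univ.2 hs))
    ⟨x, homLift h, hx, hts, mem_hilbertBall_iff.1 hh, Fin.cases (by simp) fun i => ?_⟩
  have := hzx i.succ
  simp only [homLift_succ, homLift_zero, Pi.add_apply] at this ⊢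
  linarith

lemma volume_tropPiece_le_swap {d n : ℕ} (A : Fin (d + 1) → Fin n → ℝ) (ε : ℝ)
    (s : Finset (Fin (d + 1))) (i : Fin d) :
    volume (tropPiece A ε s) ≤ volume (tropPiece (fun l => A (Equiv.swap 0 i.succ l)) ε
      (s.map (Equiv.swap 0 i.succ).toEmbedding)) := by
  set σ := Equiv.swap 0 i.succ
  have hσ : ∀ l, σ (σ l) = l := Equiv.swap_apply_self _ _
  rw [← volume_preimage_rebase i (tropPiece (fun l => A (σ l)) _ _)]
  refine measure_mono ?_
  rintro y ⟨x, h, hx, hs, hh, hy⟩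
  refine ⟨x ∘ σ, h ∘ σ, fun l => ?_, fun j => ?_, fun l l' => hh _ _, fun l => ?_⟩
  · obtain ⟨j, hj⟩ := hx (σ l)
    exact ⟨j, fun l' => hj (σ l')⟩
  · obtain ⟨a, ha, hj⟩ := hs j
    refine ⟨σ a, by simpa using ha, fun l' => ?_⟩
    simpa [hσ] using hj (σ l')
  · rw [homLift_rebase, hy, hy i.succ]
    simp [σ]

lemma card_succ_mem {d : ℕ} {s : Finset (Fin (d + 1))} (h0 : 0 ∈ s) :
    Fintype.card {i : Fin d // i.succ ∈ s} = s.card - 1 := by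
  rw [Fintype.card_subtype, ← Finset.card_erase_of_mem h0,
    ← Finset.card_map (Fin.succEmb d)]
  congr 1
  ext l
  refine Fin.cases ?_ (fun i => ?_) l
  · simp
  · simp

lemma card_succ_notMem {d : ℕ} {s : Finset (Fin (d + 1))} (h0 : 0 ∈ s) :
    Fintype.card {i : Fin d // ¬ i.succ ∈ s} = d + 1 - s.card := by
  rw [Fintype.card_subtype_compl, card_succ_mem h0, Fintype.card_fin]
  have := Finset.card_pos.2 ⟨0, h0⟩
  omega

/-- Extension by zero of a partial vector of chart coordinates. -/
def extendZero {d : ℕ} (s : Finset (Fin (d + 1))) (q : {i : Fin d // i.succ ∈ s} → ℝ) :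
    Fin d → ℝ := fun i => if h : i.succ ∈ s then q ⟨i, h⟩ else 0

lemma measurable_homLift_extendZero {d : ℕ} (s : Finset (Fin (d + 1))) (a : Fin (d + 1)) :
    Measurable fun q => homLift (extendZero s q) a := by
  refine Fin.cases (by simp) (fun i => ?_) a
  simp only [homLift_succ, extendZero]
  split_ifs with h
  · exact measurable_pi_apply _
  · exact measurable_const

lemma homLift_extendZero {d : ℕ} {s : Finset (Fin (d + 1))} (y : Fin d → ℝ)
    {a : Fin (d + 1)} (ha : a ∈ s) :
    homLift (extendZero s fun i => y i) a = homLift y a := by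
  revert ha
  refine Fin.cases (by simp) (fun i ha => ?_) a
  simp [extendZero, ha]

lemma volume_tropPiece_le_of_zero_mem {d n : ℕ} (hn : 0 < n) {A : Fin (d + 1) → Fin n → ℝ}
    (hA : ∀ i l j, A i j - A l j ≤ 1) {ε : ℝ} (hε : 0 ≤ ε) (hε1 : ε ≤ 1)
    {s : Finset (Fin (d + 1))} (h0 : 0 ∈ s) :
    volume (tropPiece A ε s) ≤
      ENNReal.ofReal (4 ^ (s.card - 1) * (2 * ε) ^ (d + 1 - s.card)) := by
  have : Nonempty (Fin n) := ⟨⟨0, hn⟩⟩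
  have : Nonempty s := ⟨⟨0, h0⟩⟩
  set P : Set ({i : Fin d // i.succ ∈ s} → ℝ) := Set.univ.pi fun _ => Set.Icc (-2) 2
  set B : Set ({i : Fin d // ¬ i.succ ∈ s} → ℝ) := Set.univ.pi fun _ => Set.Icc (-ε) ε
  let g : ({i : Fin d // i.succ ∈ s} → ℝ) → ({i : Fin d // ¬ i.succ ∈ s} → ℝ) :=
    fun q i => ⨅ j, ⨆ a : s, (homLift (extendZero s q) a - A a j + A i.1.succ j)
  have hg : Measurable g := by
    refine measurable_pi_lambda _ fun i => Measurable.iInf fun j => Measurable.iSup fun a => ?_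
    exact ((measurable_homLift_extendZero s a).sub_const _).add_const _
  have hvol := volume_shear (fun i : Fin d => i.succ ∈ s) (P := P) (B := B)
    (MeasurableSet.univ_pi fun _ => measurableSet_Icc)
    (MeasurableSet.univ_pi fun _ => measurableSet_Icc) hg
  have hvP : volume P = ENNReal.ofReal (4 ^ (s.card - 1)) := by
    simp only [P, volume_pi_pi, Real.volume_Icc, Finset.prod_const,
      Finset.card_univ, card_succ_mem h0]
    rw [← ENNReal.ofReal_pow (by norm_num)]
    norm_num
  have hvB : volume B = ENNReal.ofReal ((2 * ε) ^ (d + 1 - s.card)) := by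
    simp only [B, volume_pi_pi, Real.volume_Icc, Finset.prod_const,
      Finset.card_univ, card_succ_notMem h0]
    rw [← ENNReal.ofReal_pow (by linarith)]
    ring_nf
  rw [ENNReal.ofReal_mul (by positivity), ← hvP, ← hvB, ← hvol]
  refine measure_mono ?_
  rintro y ⟨x, h, hx, hs, hh, hy⟩
  have hdiff : ∀ i l, x i - x l ≤ 1 := by
    intro i l
    obtain ⟨j, hj⟩ := hx l
    linarith [hj i, hA i l j]
  constructor
  · simp only [P, Set.mem_pi, Set.mem_univ, true_imp_iff, Set.mem_Icc]
    intro i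
    have := hy i.1.succ
    rw [homLift_succ] at this
    constructor <;>
      linarith [hdiff i.1.succ 0, hdiff 0 i.1.succ, hh i.1.succ 0, hh 0 i.1.succ]
  · simp only [B, Set.mem_pi, Set.mem_univ, true_imp_iff, Set.mem_Icc, Pi.sub_apply, g]
    intro i
    have hyi := hy i.1.succ
    rw [homLift_succ] at hyi
    constructor
    · obtain ⟨j, hj⟩ := hx i.1.succ
      have h1 := ciInf_le (Set.finite_range fun j => ⨆ a : s,
        (homLift (extendZero s fun i => y i) a - A a j + A i.1.succ j)).bddBelow j
      have h2 : ⨆ a : s, (homLift (extendZero s fun i => y i) a - A a j + A i.1.succ j) ≤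
          y i + ε := by
        refine ciSup_le fun a => ?_
        rw [homLift_extendZero y a.2, hy]
        linarith [hj a, hh a i.1.succ]
      linarith
    · have h1 : y i - ε ≤ ⨅ j, ⨆ a : s,
          (homLift (extendZero s fun i => y i) a - A a j + A i.1.succ j) := by
        refine le_ciInf fun j => ?_
        obtain ⟨a, ha, hj⟩ := hs j
        refine le_ciSup_of_le (Set.finite_range _).bddAbove (⟨a, ha⟩ : s) ?_
        simp only
        rw [homLift_extendZero y ha, hy]
        linarith [hj i.1.succ, hh i.1.succ a]
      linarith

lemma volume_tropPiece_le {d n : ℕ} (hn : 0 < n) {A : Fin (d + 1) → Fin n → ℝ}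
    (hA : ∀ i l j, A i j - A l j ≤ 1) {ε : ℝ} (hε : 0 ≤ ε) (hε1 : ε ≤ 1)
    {s : Finset (Fin (d + 1))} (hs : s.Nonempty) :
    volume (tropPiece A ε s) ≤
      ENNReal.ofReal (4 ^ (s.card - 1) * (2 * ε) ^ (d + 1 - s.card)) := by
  obtain ⟨b, hb⟩ := hs
  revert hb
  refine Fin.cases (volume_tropPiece_le_of_zero_mem hn hA hε hε1) (fun i hb => ?_) b
  refine (volume_tropPiece_le_swap A ε s i).trans ?_
  have := volume_tropPiece_le_of_zero_mem hn (A := fun l => A (Equiv.swap 0 i.succ l))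
    (fun i l j => hA _ _ j) hε hε1 (s := s.map (Equiv.swap 0 i.succ).toEmbedding)
    (by simpa using hb)
  rwa [Finset.card_map] at this

/-- Upper bound for the volume of the neighbourhood in terms of the tropical rank. -/
lemma volume_tconv_add_le {d n : ℕ} (hn : 0 < n) {A : Fin (d + 1) → Fin n → ℝ}
    (hA : ∀ i l j, A i j - A l j ≤ 1) {ε : ℝ} (hε : 0 ≤ ε) (hε1 : ε ≤ 1) :
    volume (tconv (d + 1) A + hilbertBall (d + 1 - 1) ε) ≤
      ENNReal.ofReal (2 ^ (d + 1) * (4 ^ (tropRank (d + 1) n A - 1) *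
        (2 * ε) ^ (d + 1 - tropRank (d + 1) n A))) := by
  set k := tropRank (d + 1) n A with hk
  have hk1 : 1 ≤ k := one_le_tropRank d.succ_pos hn A
  calc volume (tconv (d + 1) A + hilbertBall (d + 1 - 1) ε)
      ≤ ∑ s ∈ Finset.powersetCard k Finset.univ, volume (tropPiece A ε s) :=
        (measure_mono (tconv_add_hilbertBall_subset hn A ε)).trans
          (measure_biUnion_finset_le _ _)
    _ ≤ ∑ _s ∈ Finset.powersetCard k (Finset.univ : Finset (Fin (d + 1))),
          ENNReal.ofReal (4 ^ (k - 1) * (2 * ε) ^ (d + 1 - k)) := by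
        refine Finset.sum_le_sum fun s hs => ?_
        have hc := Finset.mem_powersetCard_univ.1 hs
        have := volume_tropPiece_le hn hA hε hε1 (s := s) (Finset.card_pos.1 (by omega))
        rwa [hc] at this
    _ ≤ _ := by
        rw [Finset.sum_const, Finset.card_powersetCard, Finset.card_univ, Fintype.card_fin,
          nsmul_eq_mul, ENNReal.ofReal_mul (by positivity : (0 : ℝ) ≤ 2 ^ (d + 1)),
          ← ENNReal.ofReal_natCast]
        gcongr
        exact_mod_cast Nat.choose_le_two_pow _ _

lemma le_volume_tropPiece_of_zero_mem {d n k : ℕ} (hk : 0 < k) {A : Fin (d + 1) → Fin n → ℝ}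
    {r : Fin k → Fin (d + 1)} (hr : Function.Injective r) (c : Fin k → Fin n)
    {x₀ : Fin k → ℝ} {δ ε : ℝ} (hε : 0 ≤ ε)
    (hx₀ : ∀ a b, a ≠ b → x₀ a - x₀ b ≤ A (r a) (c b) - A (r b) (c b) - δ)
    {a₀ : Fin k} (ha₀ : r a₀ = 0) :
    (k * ENNReal.ofReal δ ^ (k - 1)) *
        ENNReal.ofReal (kappa (d + 1 - k) * (ε / √2) ^ (d + 1 - k)) ≤
      volume (tropPiece A ε Finset.univ) := by
  have : Nonempty (Fin k) := ⟨a₀⟩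
  set s : Finset (Fin (d + 1)) := Finset.univ.image r
  have hrs : ∀ a, r a ∈ s := fun a => Finset.mem_image_of_mem r (Finset.mem_univ a)
  have h0 : 0 ∈ s := ha₀ ▸ hrs a₀
  have hcard : s.card = k := by
    simp [s, Finset.card_image_of_injective _ hr]
  set X : Fin (d + 1) → ℝ := Function.extend r x₀ 0
  have hX : ∀ a, X (r a) = x₀ a := fun a => hr.extend_apply _ _ a
  set H : Set ({i : Fin d // i.succ ∈ s} → ℝ) :=
    {y | (∀ i, |y i| ≤ δ) ∧ ∀ i j, y i - y j ≤ δ}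
  set t : {i : Fin d // i.succ ∈ s} → ℝ := fun i => -(X i.1.succ - X 0)
  set P : Set ({i : Fin d // i.succ ∈ s} → ℝ) := (fun q => q + t) ⁻¹' H
  set B : Set ({i : Fin d // ¬ i.succ ∈ s} → ℝ) := {v | ∑ i, v i ^ 2 ≤ (ε / √2) ^ 2}
  let g : ({i : Fin d // i.succ ∈ s} → ℝ) → ({i : Fin d // ¬ i.succ ∈ s} → ℝ) :=
    fun q i => ⨅ b, (homLift (extendZero s q) (r b) - A (r b) (c b) + A i.1.succ (c b))
  have hHm : MeasurableSet H := by
    refine IsClosed.measurableSet ?_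
    have : H = (⋂ i, {y | |y i| ≤ δ}) ∩ ⋂ i, ⋂ j, {y | y i - y j ≤ δ} := by
      ext y
      simp [H]
    rw [this]
    exact (isClosed_iInter fun i => isClosed_le (by fun_prop) continuous_const).inter
      (isClosed_iInter fun i => isClosed_iInter fun j =>
        isClosed_le (by fun_prop) continuous_const)
  have hPm : MeasurableSet P := measurable_add_const t hHm
  have hBm : MeasurableSet B :=
    (isClosed_le (by fun_prop) continuous_const).measurableSet
  have hg : Measurable g := by
    refine measurable_pi_lambda _ fun i => Measurable.iInf fun b => ?_
    exact ((measurable_homLift_extendZero s (r b)).sub_const _).add_const _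
  have hvP : k * ENNReal.ofReal δ ^ (k - 1) ≤ volume P := by
    have h := le_volume_hilbert (ι := {i : Fin d // i.succ ∈ s}) (δ := δ)
    rw [card_succ_mem h0, hcard] at h
    rw [measure_preimage_add_right]
    refine le_trans (le_of_eq ?_) h
    congr 1
    exact_mod_cast (Nat.sub_add_cancel hk).symm
  have hvB : volume B = ENNReal.ofReal (kappa (d + 1 - k) * (ε / √2) ^ (d + 1 - k)) := by
    rw [volume_sum_sq_le (by positivity), card_succ_notMem h0, hcard]
  rw [← hvB]
  refine (mul_le_mul_left hvP _).trans ?_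
  rw [← volume_shear (fun i : Fin d => i.succ ∈ s) hPm hBm hg]
  refine measure_mono ?_
  rintro y ⟨⟨hy1, hy2⟩, hyB⟩
  set q : Fin k → ℝ := fun b => homLift y (r b)
  have hq : ∀ a b, a ≠ b → q a - q b ≤ A (r a) (c b) - A (r b) (c b) := by
    intro a b hab
    have key : ∀ i j, i ∈ s → j ∈ s →
        (homLift y i - X i) - (homLift y j - X j) ≤ δ ∨ i = j := by
      intro i j
      refine Fin.cases (fun _ => ?_) (fun i' hi => ?_) i <;>
        refine Fin.cases (fun _ => ?_) (fun j' hj => ?_) j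
      · exact Or.inr rfl
      · have := neg_le_of_abs_le (hy1 ⟨j', hj⟩)
        simp only [Pi.add_apply, t] at this
        left
        simp only [homLift_zero, homLift_succ]
        linarith
      · have := le_of_abs_le (hy1 ⟨i', hi⟩)
        simp only [Pi.add_apply, t] at this
        left
        simp only [homLift_zero, homLift_succ]
        linarith
      · have := hy2 ⟨i', hi⟩ ⟨j', hj⟩
        simp only [Pi.add_apply, t] at this
        left
        simp only [homLift_succ]
        linarith
    rcases key (r a) (r b) (hrs a) (hrs b) with h | h
    · rw [hX, hX] at h
      have := hx₀ a b hab
      simp only [q]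
      linarith
    · exact absurd (hr h) hab
  set z : Fin (d + 1) → ℝ := fun i => ⨅ b, (q b - A (r b) (c b) + A i (c b))
  have hzle : ∀ i b, z i ≤ q b - A (r b) (c b) + A i (c b) := fun i b =>
    ciInf_le (Set.finite_range fun b => q b - A (r b) (c b) + A i (c b)).bddBelow b
  have hz : ∀ a, z (r a) = q a := by
    intro a
    refine le_antisymm (by linarith [hzle (r a) a]) (le_ciInf fun b => ?_)
    by_cases hab : a = b
    · subst hab
      linarith
    · linarith [hq a b hab]
  set h : Fin (d + 1) → ℝ := fun i => homLift y i - z i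
  have hs0 : ∀ i ∈ s, h i = 0 := by
    intro i hi
    obtain ⟨a, -, rfl⟩ := Finset.mem_image.1 hi
    simp [h, hz, q]
  have hsum : ∑ i, h i ^ 2 ≤ (ε / √2) ^ 2 := by
    rw [Fin.sum_univ_succ, hs0 0 h0,
      ← Fintype.sum_subtype_add_sum_subtype (fun i : Fin d => i.succ ∈ s)]
    rw [Finset.sum_eq_zero (s := Finset.univ) fun (i : {i : Fin d // i.succ ∈ s}) _ => by
      rw [hs0 _ i.2, zero_pow two_ne_zero], zero_pow two_ne_zero, zero_add, zero_add]
    refine le_trans (le_of_eq (Finset.sum_congr rfl fun i _ => ?_)) hyB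
    simp only [Pi.sub_apply, g, h, z, q, homLift_succ]
    simp only [homLift_extendZero y (hrs _)]
  have hsq : (ε / √2) ^ 2 = ε ^ 2 / 2 := by
    rw [div_pow, Real.sq_sqrt (by norm_num)]
  refine ⟨z, h, fun i => ?_, fun j => ?_, fun i l => ?_, fun i => ?_⟩
  · obtain ⟨b, hb⟩ := exists_eq_ciInf_of_finite
      (f := fun b => q b - A (r b) (c b) + A i (c b))
    refine ⟨c b, fun l => ?_⟩
    have : q b - A (r b) (c b) + A i (c b) = z i := hb
    linarith [hzle l b]
  · obtain ⟨a, ha⟩ := Finite.exists_max fun i => z i - A i j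
    exact ⟨a, Finset.mem_univ _, ha⟩
  · by_cases hil : i = l
    · simp [hil, hε]
    · have hpair : h i ^ 2 + h l ^ 2 ≤ ∑ i, h i ^ 2 := by
        rw [← Finset.sum_pair (f := fun i => h i ^ 2) hil]
        exact Finset.sum_le_sum_of_subset_of_nonneg (Finset.subset_univ _)
          fun _ _ _ => sq_nonneg _
      refine le_of_abs_le (abs_le_of_sq_le_sq ?_ hε)
      nlinarith [sq_nonneg (h i + h l)]
  · have := hs0 0 h0
    simp only [h, homLift_zero] at this ⊢
    linarith

/-- Lower bound for the volume of the neighbourhood in terms of the tropical rank. -/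
lemma le_volume_tconv_add {d n : ℕ} (hn : 0 < n) {A : Fin (d + 1) → Fin n → ℝ}
    (hA : ∀ i j, ∃ z : ℤ, A i j = z) {ε : ℝ} (hε : 0 ≤ ε) :
    (tropRank (d + 1) n A *
        ENNReal.ofReal (1 / tropRank (d + 1) n A) ^ (tropRank (d + 1) n A - 1)) *
        ENNReal.ofReal (kappa (d + 1 - tropRank (d + 1) n A) *
          (ε / √2) ^ (d + 1 - tropRank (d + 1) n A)) ≤
      volume (tconv (d + 1) A + hilbertBall (d + 1 - 1) ε) := by
  obtain ⟨r, c, hr, -, hns⟩ := tropRank_spec A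
  have hk : 0 < tropRank (d + 1) n A := one_le_tropRank d.succ_pos hn A
  generalize tropRank (d + 1) n A = k at *
  obtain ⟨σ, x, hx⟩ := hns.exists_potential hk fun i j => hA _ _
  refine le_trans ?_ (measure_mono (tropPiece_univ_subset hn A ε))
  obtain ⟨b, hb⟩ : ∃ b, r ⟨0, hk⟩ = b := ⟨_, rfl⟩
  revert hb
  refine Fin.cases (fun hb => ?_) (fun i hb => ?_) b
  · exact le_volume_tropPiece_of_zero_mem hk hr (c ∘ σ) hε hx hb
  · have h := volume_tropPiece_le_swap (fun l => A (Equiv.swap 0 i.succ l)) ε Finset.univ i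
    simp only [Equiv.swap_apply_self, Finset.map_univ_equiv] at h
    refine le_trans ?_ h
    refine le_volume_tropPiece_of_zero_mem hk
      (r := fun a => Equiv.swap 0 i.succ (r a)) ((Equiv.injective _).comp hr) (c ∘ σ)
      (x₀ := x) hε ?_ (a₀ := ⟨0, hk⟩) (by simp [hb])
    simpa using hx

lemma kappa_pos (d : ℕ) : 0 < kappa d :=
  div_pos (Real.rpow_pos_of_pos Real.pi_pos _) (Real.Gamma_pos_of_pos (by positivity))

lemma two_rpow_mul_pow {m k : ℕ} (hkm : k ≤ m) (ε : ℝ) :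
    (2 : ℝ) ^ (((k : ℝ) - m) / 2) * ε ^ (m - k) = (ε / √2) ^ (m - k) := by
  have h : ((k : ℝ) - m) / 2 = (-(1 / 2)) * ((m - k : ℕ) : ℝ) := by
    rw [Nat.cast_sub hkm]
    ring
  rw [h, Real.rpow_mul (by norm_num), Real.rpow_natCast, Real.rpow_neg (by norm_num),
    ← Real.sqrt_eq_rpow, ← mul_pow]
  ring

lemma natCast_rpow_two_sub {k : ℕ} (hk : 1 ≤ k) :
    (k : ℝ) ^ ((2 : ℝ) - k) = k * (1 / k) ^ (k - 1) := by
  have hk' : (0 : ℝ) < k := by exact_mod_cast hk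
  have h : (2 : ℝ) - k = 1 - ((k - 1 : ℕ) : ℝ) := by
    rw [Nat.cast_sub hk]
    push_cast
    ring
  rw [h, Real.rpow_sub hk', Real.rpow_one, Real.rpow_natCast, one_div, inv_pow, div_eq_mul_inv]

lemma two_pow_mul_le {m n k : ℕ} (hm : 2 ≤ m) (hn : 1 ≤ n) (hk : 1 ≤ k) (hkm : k ≤ m)
    {ε : ℝ} (hε : 0 ≤ ε) :
    2 ^ m * (4 ^ (k - 1) * (2 * ε) ^ (m - k)) ≤
      2 ^ m * 3 ^ (m + n - 2) * (2 * √((m : ℝ) - 1)) ^ ((k : ℝ) - 1) * ε ^ (m - k) := by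
  have hm' : (2 : ℝ) ≤ m := by exact_mod_cast hm
  have hb : 2 ≤ 2 * √((m : ℝ) - 1) := by
    have : 1 ≤ √((m : ℝ) - 1) := Real.one_le_sqrt.2 (by linarith)
    linarith
  have h1 : (2 * √((m : ℝ) - 1)) ^ ((k : ℝ) - 1) = (2 * √((m : ℝ) - 1)) ^ (k - 1) := by
    rw [← Real.rpow_natCast, Nat.cast_sub hk, Nat.cast_one]
  have h2 : (2 : ℝ) ^ (k - 1) ≤ (2 * √((m : ℝ) - 1)) ^ (k - 1) :=
    pow_le_pow_left₀ (by norm_num) hb _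
  have h3 : (2 : ℝ) ^ (m - 1) ≤ 3 ^ (m + n - 2) :=
    (pow_le_pow_left₀ (by norm_num) (by norm_num) _).trans
      (pow_le_pow_right₀ (by norm_num) (by omega))
  have h4 : (2 : ℝ) ^ (m - 1) = 2 ^ (k - 1) * 2 ^ (m - k) := by
    rw [← pow_add]
    congr 1
    omega
  rw [h1]
  calc (2 : ℝ) ^ m * (4 ^ (k - 1) * (2 * ε) ^ (m - k))
      = 2 ^ m * 2 ^ (m - 1) * 2 ^ (k - 1) * ε ^ (m - k) := by
        rw [h4, show (4 : ℝ) = 2 * 2 by norm_num, mul_pow, mul_pow]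
        ring
    _ ≤ 2 ^ m * 3 ^ (m + n - 2) * (2 * √((m : ℝ) - 1)) ^ (k - 1) * ε ^ (m - k) :=
        mul_le_mul_of_nonneg_right
          (mul_le_mul (mul_le_mul_of_nonneg_left h3 (by positivity)) h2 (by positivity)
            (by positivity)) (by positivity)

/-- For a `{0,1}` matrix `A` with `R = 1` and suitably small `ε`, the tropical rank of
`A` equals `k` iff the volume of `tconv(A) + B_H(ε)` lies in
`[C⁻(k)·ε^(m−k), C⁺(k)·ε^(m−k)]`. -/
theorem stmt13 (m n : ℕ) (hm : 2 ≤ m) (hn : 1 ≤ n) (A : Fin m → Fin n → ℝ)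
    (hA01 : ∀ i j, A i j = 0 ∨ A i j = 1)
    (hR : (⨆ i : Fin m, ((⨆ j, (A i j - A ⟨0, by omega⟩ j)) -
        ⨅ j, (A i j - A ⟨0, by omega⟩ j))) = 1)
    (Cminus Cplus : ℕ → ℝ)
    (hCm : ∀ k : ℕ, Cminus k =
      (2 : ℝ) ^ (((k : ℝ) - (m : ℝ)) / 2) * kappa (m - k) * (k : ℝ) ^ ((2 : ℝ) - (k : ℝ)))
    (hCp : ∀ j : ℕ, Cplus j =
      2 ^ m * 3 ^ (m + n - 2) * (2 * Real.sqrt ((m : ℝ) - 1)) ^ ((j : ℝ) - 1))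
    (εbar : ℝ)
    (hεbar : εbar = sInf {x : ℝ | ∃ k : ℕ, 1 ≤ k ∧ k ≤ m ∧ x = Cminus k / Cplus (k - 1)})
    (ε : ℝ) (hε0 : 0 < ε) (hεlt : ε < min εbar 1)
    (k : ℕ) (hk1 : 1 ≤ k) (hkm : k ≤ m) :
    tropRank m n A = k ↔
      (ENNReal.ofReal (Cminus k * ε ^ (m - k)) ≤
          volume (tconv m A + hilbertBall (m - 1) ε) ∧
        volume (tconv m A + hilbertBall (m - 1) ε) ≤
          ENNReal.ofReal (Cplus k * ε ^ (m - k))) := by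
  obtain ⟨d, rfl⟩ : ∃ d, m = d + 1 := ⟨m - 1, by omega⟩
  have hε1 : ε < 1 := hεlt.trans_le (min_le_right _ _)
  have hdiff : ∀ i l j, A i j - A l j ≤ 1 := by
    intro i l j
    rcases hA01 i j with h | h <;> rcases hA01 l j with h' | h' <;> rw [h, h'] <;> norm_num
  have hint : ∀ i j, ∃ z : ℤ, A i j = z := by
    intro i j
    rcases hA01 i j with h | h
    · exact ⟨0, by simp [h]⟩
    · exact ⟨1, by simp [h]⟩
  have hb : 1 ≤ 2 * √(((d + 1 : ℕ) : ℝ) - 1) := by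
    have : (2 : ℝ) ≤ ((d + 1 : ℕ) : ℝ) := by exact_mod_cast hm
    have : 1 ≤ √(((d + 1 : ℕ) : ℝ) - 1) := Real.one_le_sqrt.2 (by linarith)
    linarith
  have hCp_pos : ∀ j, 0 < Cplus j := by
    intro j
    rw [hCp]
    have := Real.rpow_pos_of_pos (zero_lt_one.trans_le hb) ((j : ℝ) - 1)
    positivity
  have hCp_mono : ∀ i j, i ≤ j → Cplus i ≤ Cplus j := by
    intro i j hij
    rw [hCp, hCp]
    have : (i : ℝ) ≤ j := by exact_mod_cast hij
    exact mul_le_mul_of_nonneg_left (Real.rpow_le_rpow_of_exponent_le hb (by linarith))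
      (by positivity)
  have hCm_pos : ∀ j, 1 ≤ j → 0 < Cminus j := by
    intro j hj
    rw [hCm]
    have h1 : (0 : ℝ) < j := by exact_mod_cast hj
    have := kappa_pos (d + 1 - j)
    have := Real.rpow_pos_of_pos h1 (2 - (j : ℝ))
    positivity
  have hε_lt : ∀ j, 1 ≤ j → j ≤ d + 1 → ε * Cplus (j - 1) < Cminus j := by
    intro j hj hjm
    rw [← lt_div_iff₀ (hCp_pos _)]
    refine (hεlt.trans_le (min_le_left _ _)).trans_le ?_
    rw [hεbar]
    refine csInf_le ⟨0, ?_⟩ ⟨j, hj, hjm, rfl⟩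
    rintro _ ⟨i, hi, -, rfl⟩
    exact (div_pos (hCm_pos i hi) (hCp_pos _)).le
  have hgap : ∀ i j, i < j → j ≤ d + 1 →
      Cplus i * ε ^ (d + 1 - i) < Cminus j * ε ^ (d + 1 - j) := by
    intro i j hij hj
    calc Cplus i * ε ^ (d + 1 - i) ≤ Cplus (j - 1) * ε ^ (d + 1 - j + 1) :=
          mul_le_mul (hCp_mono i (j - 1) (by omega))
            (pow_le_pow_of_le_one hε0.le hε1.le (by omega)) (by positivity) (hCp_pos _).le
      _ = (ε * Cplus (j - 1)) * ε ^ (d + 1 - j) := by ring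
      _ < Cminus j * ε ^ (d + 1 - j) :=
          mul_lt_mul_of_pos_right (hε_lt j (by omega) hj) (by positivity)
  have hrank1 : 1 ≤ tropRank (d + 1) n A := one_le_tropRank d.succ_pos hn A
  have hrankm : tropRank (d + 1) n A ≤ d + 1 := tropRank_le_left A
  have hlow := le_volume_tconv_add hn hint hε0.le
  have hupp := (volume_tconv_add_le hn hdiff hε0.le hε1.le).trans
    (ENNReal.ofReal_le_ofReal (two_pow_mul_le hm hn hrank1 hrankm hε0.le))
  rw [← hCp] at hupp
  replace hlow : ENNReal.ofReal (Cminus (tropRank (d + 1) n A) *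
      ε ^ (d + 1 - tropRank (d + 1) n A)) ≤
      volume (tconv (d + 1) A + hilbertBall (d + 1 - 1) ε) := by
    refine le_trans (le_of_eq ?_) hlow
    rw [← ENNReal.ofReal_natCast, ← ENNReal.ofReal_pow (by positivity),
      ← ENNReal.ofReal_mul (by positivity), ← ENNReal.ofReal_mul (by positivity),
      ← natCast_rpow_two_sub hrank1, ← two_rpow_mul_pow hrankm, hCm]
    congr 1
    ring
  generalize tropRank (d + 1) n A = k' at *
  constructor
  · rintro rfl
    exact ⟨hlow, hupp⟩
  · rintro ⟨h1, h2⟩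
    have hle1 := (ENNReal.ofReal_le_ofReal_iff (mul_pos (hCp_pos k) (by positivity)).le).1
      (hlow.trans h2)
    have hle2 := (ENNReal.ofReal_le_ofReal_iff (mul_pos (hCp_pos k') (by positivity)).le).1
      (h1.trans hupp)
    rcases lt_trichotomy k' k with h | h | h
    · exact absurd hle2 (not_le.2 (hgap k' k h hkm))
    · exact h
    · exact absurd hle1 (not_le.2 (hgap k k' h hrankm))
end
end

section
/- Let A ∈ ℤ^{m×n} with m ≥ 2, let k be the tropical rank of A, let R := max_{1≤i≤m} ( max_{1≤j≤n}(A_{ij} − A_{1j}) − min_{1≤j≤n}(A_{ij} − A_{1j}) ), assumed to satisfy R ≥ 1, and let s be a positive integer. Then the number of integer points in the dilated tropical polytope s·tconv(A) = {s·y : y ∈ tconv(A)} ⊆ ℝ^{m−1} satisfies |s·tconv(A) ∩ ℤ^{m−1}| ≤ 3^{m+n−2} · ((1 + 2sR√(m−1))^k − 1)/(2sR√(m−1)). -/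
open MeasureTheory Pointwise

noncomputable section

open Finset in
/-- A bipartite graph without isolated vertices has a spanning forest, given by parent maps `pa`, `pb`
decreasing a height `h`, whose roots `S` lie on the left and meet every component once. -/
theorem exists_parents {α β : Type*} [Fintype α] (r : α → β → Prop)
    (hl : ∀ i, ∃ j, r i j) (hr : ∀ j, ∃ i, r i j) (i₀ : α) :
    ∃ (S : Finset α) (h : α ⊕ β → ℕ) (pa : α → β) (pb : β → α),
      i₀ ∈ S ∧ (∀ i ∈ S, ∀ i' ∈ S, ∀ j, r i j → r i' j → i = i') ∧
      (∀ i ∉ S, r i (pa i) ∧ h (.inr (pa i)) < h (.inl i)) ∧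
      (∀ j, r (pb j) j ∧ h (.inl (pb j)) < h (.inr j)) ∧
      (∀ i ∈ S, ∀ j, r i j → pb j = i) := by
  classical
  let G : SimpleGraph (α ⊕ β) :=
    { Adj := fun u v => Sum.elim (fun i => Sum.elim (fun _ => False) (fun j => r i j) v)
        (fun j => Sum.elim (fun i => r i j) (fun _ => False) v) u
      symm := ⟨by rintro (i | j) (i' | j') <;> simp⟩
      loopless := ⟨by rintro (i | j) <;> simp⟩ }
  have adj : ∀ i j, G.Adj (.inl i) (.inr j) ↔ r i j := fun i j => Iff.rfl
  have rep : ∀ c : G.ConnectedComponent, ∃ i : α, G.connectedComponentMk (.inl i) = c := by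
    intro c
    induction c using SimpleGraph.ConnectedComponent.ind with
    | _ v =>
      rcases v with i | j
      · exact ⟨i, rfl⟩
      · obtain ⟨i, hi⟩ := hr j
        exact ⟨i, SimpleGraph.ConnectedComponent.sound ((adj i j).2 hi).reachable⟩
  obtain ⟨ρ, hρ, hρ₀⟩ : ∃ ρ : G.ConnectedComponent → α,
      (∀ c, G.connectedComponentMk (.inl (ρ c)) = c) ∧
      ρ (G.connectedComponentMk (.inl i₀)) = i₀ := by
    choose ρ hρ using rep
    refine ⟨Function.update ρ (G.connectedComponentMk (.inl i₀)) i₀, fun c => ?_, by simp⟩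
    by_cases hc : c = G.connectedComponentMk (.inl i₀)
    · subst hc; simp
    · simp [Function.update_of_ne hc, hρ]
  let root : α ⊕ β → α ⊕ β := fun v => .inl (ρ (G.connectedComponentMk v))
  have root_reach : ∀ v, G.Reachable v (root v) := fun v =>
    SimpleGraph.ConnectedComponent.exact (hρ _).symm
  have root_adj : ∀ {u v}, G.Adj u v → root u = root v := fun {u v} huv => by
    simp only [root]
    rw [SimpleGraph.ConnectedComponent.sound huv.reachable]
  let h : α ⊕ β → ℕ := fun v => G.dist v (root v)
  have step : ∀ v, v ≠ root v → ∃ u, G.Adj v u ∧ h u < h v := by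
    intro v hv
    obtain ⟨w, hw⟩ := (root_reach v).exists_walk_length_eq_dist
    have aux : ∀ {t} (w : G.Walk v t), v ≠ t → ∃ u, G.Adj v u ∧ G.dist u t < w.length := by
      intro t w hvt
      cases w with
      | nil => exact absurd rfl hvt
      | cons a q =>
        exact ⟨_, a, by simpa [Nat.lt_succ_iff] using SimpleGraph.dist_le q⟩
    obtain ⟨u, hu, hlt⟩ := aux w hv
    refine ⟨u, hu, ?_⟩
    simp only [h, ← root_adj hu]
    omega
  have root_mk : ∀ c, root (.inl (ρ c)) = .inl (ρ c) := fun c => by simp only [root, hρ]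
  have ha : ∀ i, ∃ j, i ∉ univ.filter (fun i => root (.inl i) = .inl i) →
      r i j ∧ h (.inr j) < h (.inl i) := by
    intro i
    by_cases hi : root (.inl i) = .inl i
    · obtain ⟨j, -⟩ := hl i
      exact ⟨j, fun hh => absurd (by simpa using hi) hh⟩
    · obtain ⟨u | j, hu, hlt⟩ := step (.inl i) (Ne.symm hi)
      · exact hu.elim
      · exact ⟨j, fun _ => ⟨hu, hlt⟩⟩
  have hb : ∀ j, ∃ i, r i j ∧ h (.inl i) < h (.inr j) := by
    intro j
    obtain ⟨i | u, hu, hlt⟩ := step (.inr j) (by simp [root])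
    · exact ⟨i, hu, hlt⟩
    · exact hu.elim
  choose pa hpa using ha
  choose pb hpb using hb
  have sep : ∀ i, root (.inl i) = .inl i → ∀ i', root (.inl i') = .inl i' → ∀ j,
      r i j → r i' j → i = i' := by
    intro i hi i' hi' j hij hij'
    have h1 := root_adj ((adj i j).2 hij)
    have h2 := root_adj ((adj i' j).2 hij')
    rw [hi] at h1
    rw [hi', ← h1] at h2
    exact (Sum.inl_injective h2).symm
  refine ⟨univ.filter (fun i => root (.inl i) = .inl i), h, pa, pb, ?_, ?_, hpa, hpb, ?_⟩
  · simp [root, hρ₀]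
  · simpa using sep
  · intro i hi j hij
    replace hi : root (.inl i) = .inl i := by simpa using hi
    have h1 : root (.inr j) = .inl i := by rw [← root_adj ((adj i j).2 hij), hi]
    have h2 : h (.inr j) = 1 := by
      simp only [h, h1]
      exact SimpleGraph.dist_eq_one_iff_adj.2 ((adj i j).2 hij).symm
    have h3 : h (.inl (pb j)) = 0 := by have := (hpb j).2; omega
    have h4 : root (.inl (pb j)) = .inl (pb j) :=
      ((root_reach _).dist_eq_zero_iff.1 h3).symm
    exact sep _ h4 _ hi j (hpb j).1 hij

open Finset in
/-- The left degree vector `L` of a spanning forest rooted at a set `S` of left vertices, with the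
counting inequalities it satisfies against sets closed under one side of the adjacency relation. -/
theorem exists_roots_degrees {α β : Type*} [Fintype α] [Fintype β] [DecidableEq α]
    (r : α → β → Prop)
    (hl : ∀ i, ∃ j, r i j) (hr : ∀ j, ∃ i, r i j) (i₀ : α) :
    ∃ (S : Finset α) (L : α → ℕ), i₀ ∈ S ∧
      (∀ i ∈ S, ∀ i' ∈ S, ∀ j, r i j → r i' j → i = i') ∧ (∀ i, 1 ≤ L i) ∧
      ∑ i, L i + #S = Fintype.card α + Fintype.card β ∧
      (∀ (D : Finset α) (E : Finset β), Disjoint D S →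
        (∀ i j, j ∈ E → r i j → i ∈ D) → #D + #E ≤ ∑ i ∈ D, L i) ∧
      (∀ (D : Finset α) (E : Finset β), D.Nonempty →
        (∀ i j, i ∈ D → r i j → j ∈ E) → ∑ i ∈ D, L i < #D + #E) := by
  classical
  obtain ⟨S, h, pa, pb, h0, sep, hpa, hpb, hS⟩ := exists_parents r hl hr i₀
  let L : α → ℕ := fun i => (if i ∈ S then 0 else 1) + #{j | pb j = i}
  have sumL : ∀ D : Finset α, ∑ i ∈ D, L i = #(D \ S) + #{j | pb j ∈ D} := by
    intro D
    simp only [L, sum_add_distrib]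
    congr 1
    · rw [← filter_notMem_eq_sdiff, card_filter]
      exact sum_congr rfl fun i _ => by split_ifs <;> rfl
    · rw [card_eq_sum_card_fiberwise (f := pb) (t := D) (by intro j; simp)]
      refine sum_congr rfl fun i hi => ?_
      congr 1
      ext j
      simp only [mem_filter, mem_univ, true_and]
      exact ⟨fun h => ⟨h ▸ hi, h⟩, fun h => h.2⟩
  refine ⟨S, L, h0, sep, fun i => ?_, ?_, fun D E hD hE => ?_, fun D E hD hE => ?_⟩
  · by_cases hi : i ∈ S
    · obtain ⟨j, hj⟩ := hl i
      have : 0 < #{j | pb j = i} := card_pos.2 ⟨j, by simpa using hS i hi j hj⟩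
      simp only [L]; omega
    · simp [L, hi]
  · rw [sumL]
    have := card_sdiff_add_card_eq_card (subset_univ S)
    simp only [mem_univ, filter_true, card_univ] at this ⊢
    omega
  · rw [sumL, sdiff_eq_self_of_disjoint hD]
    gcongr
    intro j hj
    simpa using hE _ _ hj (hpb j).1
  · rw [sumL]
    have hsub : ({j | pb j ∈ D} : Finset β) ⊆ E := fun j hj =>
      hE _ _ (by simpa using hj) (hpb j).1
    have hsub' : D \ S ⊆ D := sdiff_subset
    by_contra hcon
    have c1 := card_le_card hsub
    have c2 := card_le_card hsub'
    have e1 : ({j | pb j ∈ D} : Finset β) = E := eq_of_subset_of_card_le hsub (by omega)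
    have e2 : D \ S = D := eq_of_subset_of_card_le hsub' (by omega)
    obtain ⟨i, hi⟩ := hD
    obtain ⟨v, hv, hmin⟩ := exists_min_image (D.disjSum E) h ⟨.inl i, by simpa using hi⟩
    rcases v with i | j
    · have hi : i ∈ D := by simpa using hv
      have hiS : i ∉ S := by rw [← e2] at hi; exact (mem_sdiff.1 hi).2
      have := hmin (.inr (pa i)) (by simpa using hE _ _ hi (hpa i hiS).1)
      exact absurd (hpa i hiS).2 (by omega)
    · have hj : j ∈ E := by simpa using hv
      rw [← e1] at hj
      have := hmin (.inl (pb j)) (by simpa using hj)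
      exact absurd (hpb j).2 (by omega)

open Finset in
/-- The number of connected components of the type graph of a point of a tropical polytope is at most
the tropical rank. -/
theorem card_le_tropRank {m n : ℕ} (A : Fin m → Fin n → ℝ) (x : Fin m → ℝ) (a : Fin n → ℝ)
    (hle : ∀ i j, x i ≤ a j + A i j) (hl : ∀ i, ∃ j, x i = a j + A i j)
    (S : Finset (Fin m))
    (hS : ∀ i ∈ S, ∀ i' ∈ S, ∀ j, x i = a j + A i j → x i' = a j + A i' j → i = i') :
    #S ≤ tropRank m n A := by
  choose c hc using hl
  refine le_csSup ⟨m, ?_⟩ ?_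
  · rintro k ⟨r, -, hr, -⟩
    simpa using Fintype.card_le_of_injective r hr
  · let r : Fin #S → Fin m := fun t => S.equivFin.symm t
    have hrS : ∀ t, r t ∈ S := fun t => (S.equivFin.symm t).2
    have hr : Function.Injective r := Subtype.val_injective.comp S.equivFin.symm.injective
    have key : ∀ t t', x (r t) = a (c (r t')) + A (r t) (c (r t')) → t = t' := fun t t' h =>
      hr (hS _ (hrS _) _ (hrS _) _ h (hc _))
    have hsum : ∀ τ : Equiv.Perm (Fin #S),
        ∑ t, (a (c (r (τ t))) + A (r t) (c (r (τ t)))) =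
          ∑ t, a (c (r t)) + ∑ t, A (r t) (c (r (τ t))) := fun τ => by
      rw [sum_add_distrib, Equiv.sum_comp τ (fun t => a (c (r t)))]
    have hone : ∑ t, x (r t) = ∑ t, a (c (r t)) + ∑ t, A (r t) (c (r t)) := by
      rw [← sum_add_distrib]
      exact sum_congr rfl fun t _ => hc _
    refine ⟨r, c ∘ r, hr, fun t t' h => key t t' ?_, 1, fun τ => ?_, fun τ hτ => ?_⟩
    · have := hc (r t)
      simp only [Function.comp] at h
      rwa [h] at this
    · have := sum_le_sum fun t (_ : t ∈ univ) => hle (r t) (c (r (τ t)))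
      rw [hsum, hone] at this
      simpa using this
    · have h1 := hτ 1
      simp only [Function.comp, Equiv.Perm.coe_one, id] at h1
      have h2 : ∑ t, x (r t) = ∑ t, (a (c (r (τ t))) + A (r t) (c (r (τ t)))) :=
        le_antisymm (sum_le_sum fun t _ => hle _ _) (by rw [hsum, hone]; linarith)
      rw [sum_eq_sum_iff_of_le fun t _ => hle _ _] at h2
      ext t
      rw [← key t (τ t) (h2 t (mem_univ t))]
      rfl

open Finset in
/-- Two points whose spanning forests have the same roots and left degrees are comparable as soon as
they agree at the roots. -/
theorem le_of_degrees_eq {α β : Type*} [Fintype α] [Fintype β]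
    (A : α → β → ℝ) (x x' : α → ℝ) (a a' : β → ℝ)
    (hle : ∀ i j, x i ≤ a j + A i j) (hle' : ∀ i j, x' i ≤ a' j + A i j)
    (S : Finset α) (L : α → ℕ)
    (hL : ∀ (D : Finset α) (E : Finset β), Disjoint D S →
        (∀ i j, j ∈ E → x i = a j + A i j → i ∈ D) → #D + #E ≤ ∑ i ∈ D, L i)
    (hL' : ∀ (D : Finset α) (E : Finset β), D.Nonempty →
        (∀ i j, i ∈ D → x' i = a' j + A i j → j ∈ E) → ∑ i ∈ D, L i < #D + #E)
    (hS : ∀ i ∈ S, x i = x' i) (i : α) : x i ≤ x' i := by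
  classical
  by_contra! hi
  obtain ⟨i₁, -, hmax⟩ := exists_max_image univ (fun i => x i - x' i) ⟨i, mem_univ i⟩
  have hpos := hmax i (mem_univ i)
  let D : Finset α := {i | x i - x' i = x i₁ - x' i₁}
  let E : Finset β := {j | x i₁ - x' i₁ ≤ a j - a' j}
  refine absurd (hL D E ?_ fun i j hj h => ?_) (not_le.2 (hL' D E ⟨i₁, ?_⟩ fun i j hi h => ?_))
  · refine disjoint_left.2 fun t ht htS => ?_
    have := hS t htS
    simp only [D, mem_filter, mem_univ, true_and] at ht
    linarith
  · have := hmax i (mem_univ i)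
    have := hle' i j
    simp only [E, D, mem_filter, mem_univ, true_and] at hj ⊢
    linarith
  · simp [D]
  · have := hle i j
    simp only [E, D, mem_filter, mem_univ, true_and] at hi ⊢
    linarith

open Finset in
/-- A min-plus combination can be rewritten with residuated coefficients, for which every row and
every column has a tight entry. -/
theorem exists_residuation {ι κ : Type*} [Fintype ι] [Fintype κ] [Nonempty ι] [Nonempty κ]
    (A : ι → κ → ℝ) (α : κ → ℝ) (c : ℝ) :
    ∃ a : κ → ℝ, (∀ i j, (⨅ j, (α j + A i j)) - c ≤ a j + A i j) ∧
      (∀ i, ∃ j, (⨅ j, (α j + A i j)) - c = a j + A i j) ∧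
      (∀ j, ∃ i, (⨅ j, (α j + A i j)) - c = a j + A i j) := by
  set x : ι → ℝ := fun i => (⨅ j, (α j + A i j)) - c with hx
  have h1 : ∀ i j, x i ≤ α j - c + A i j := fun i j => by
    have := ciInf_le (Set.finite_range fun j => α j + A i j).bddBelow j
    simp only [hx]; linarith
  have h2 : ∀ j, ∃ i, ∀ i', x i' - A i' j ≤ x i - A i j := fun j =>
    Finite.exists_max fun i => x i - A i j
  choose p hp using h2
  refine ⟨fun j => x (p j) - A (p j) j, fun i j => ?_, fun i => ?_, fun j => ⟨p j, ?_⟩⟩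
  · have := hp j i
    change x i ≤ _
    linarith
  · obtain ⟨j, hj⟩ := exists_eq_ciInf_of_finite (f := fun j => α j + A i j)
    refine ⟨j, ?_⟩
    have e : x i = α j - c + A i j := by simp only [hx, ← hj]; ring
    change x i = _
    have := hp j i
    have := h1 (p j) j
    linarith
  · change x (p j) = _
    ring

theorem card_Icc_ceil_floor_le {a b : ℝ} (hab : a ≤ b) :
    ((Finset.Icc ⌈a⌉ ⌊b⌋).card : ℝ) ≤ 1 + (b - a) := by
  rw [Int.card_Icc]
  have h : (((⌊b⌋ + 1 - ⌈a⌉).toNat : ℤ) : ℝ) = max ((⌊b⌋ : ℝ) + 1 - ⌈a⌉) 0 := by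
    rw [Int.ofNat_toNat]; push_cast; rfl
  have h' : ((⌊b⌋ + 1 - ⌈a⌉).toNat : ℝ) = max ((⌊b⌋ : ℝ) + 1 - ⌈a⌉) 0 := by
    rw [← h, Int.cast_natCast]
  rw [h']
  have := Int.floor_le b
  have := Int.le_ceil a
  exact max_le (by linarith) (by linarith)

open Finset in
theorem choose_mul_choose_le_three_pow (p t d : ℕ) :
    p.choose d * (p + t).choose t ≤ 3 ^ (p + t) := by
  have h1 : p.choose d ≤ 2 ^ p := Nat.choose_le_two_pow p d
  have h2 : 2 ^ p * (p + t).choose t ≤ (2 + 1) ^ (p + t) := by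
    rw [add_pow]
    refine le_trans ?_ (single_le_sum (fun _ _ => Nat.zero_le _)
      (mem_range.2 (show p < p + t + 1 by omega)))
    simp [Nat.choose_symm_add.symm]
  exact (Nat.mul_le_mul_right _ h1).trans h2

open Finset in
/-- Every point of `tconv m A` has a spanning forest of its type graph, recorded by its set of roots
`S` and its left degrees `L`. -/
theorem tconv_point_data (m n : ℕ) (hm : 0 < m) (hn : 0 < n) (A : Fin m → Fin n → ℝ)
    (y : Fin (m - 1) → ℝ) (hy : y ∈ tconv m A) :
    ∃ (x : Fin m → ℝ) (a : Fin n → ℝ) (S : Finset (Fin m)) (L : Fin m → ℕ),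
      x ⟨0, hm⟩ = 0 ∧
      (∀ t : Fin (m - 1), x ⟨t + 1, by have := t.isLt; omega⟩ = y t) ∧
      (∀ i j, x i ≤ a j + A i j) ∧
      (∀ i, (⨅ j, (A i j - A ⟨0, hm⟩ j)) ≤ x i) ∧ (∀ i, x i ≤ ⨆ j, (A i j - A ⟨0, hm⟩ j)) ∧
      ⟨0, hm⟩ ∈ S ∧ #S ≤ tropRank m n A ∧ (∀ i, 1 ≤ L i) ∧ ∑ i, L i + #S = m + n ∧
      (∀ (D : Finset (Fin m)) (E : Finset (Fin n)), Disjoint D S →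
        (∀ i j, j ∈ E → x i = a j + A i j → i ∈ D) → #D + #E ≤ ∑ i ∈ D, L i) ∧
      (∀ (D : Finset (Fin m)) (E : Finset (Fin n)), D.Nonempty →
        (∀ i j, i ∈ D → x i = a j + A i j → j ∈ E) → ∑ i ∈ D, L i < #D + #E) := by
  obtain ⟨α, hα⟩ := hy
  have : Nonempty (Fin m) := ⟨⟨0, hm⟩⟩
  have : Nonempty (Fin n) := ⟨⟨0, hn⟩⟩
  obtain ⟨a, hle, hl, hr⟩ := exists_residuation A α (⨅ j, (α j + A ⟨0, hm⟩ j))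
  have hx0 : (⨅ j, (α j + A ⟨0, hm⟩ j)) - (⨅ j, (α j + A ⟨0, hm⟩ j)) = 0 := sub_self _
  have hxs := fun t => (hα t).symm
  generalize hx : (fun i => (⨅ j, (α j + A i j)) - ⨅ j, (α j + A ⟨0, hm⟩ j)) = x at *
  have hx' : ∀ i, (⨅ j, (α j + A i j)) - ⨅ j, (α j + A ⟨0, hm⟩ j) = x i := fun i => by
    rw [← hx]
  simp only [hx'] at hle hl hr hx0 hxs
  obtain ⟨S, L, h0, sep, hL1, hsum, hb, ha⟩ :=
    exists_roots_degrees (fun i j => x i = a j + A i j) hl hr ⟨0, hm⟩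
  refine ⟨x, a, S, L, hx0, hxs, hle, fun i => ?_, fun i => ?_, h0,
    card_le_tropRank A x a hle hl S sep, hL1, by simpa using hsum, hb, ha⟩
  · obtain ⟨j, hj⟩ := hl i
    have h1 := hle ⟨0, hm⟩ j
    have h2 := ciInf_le (Set.finite_range fun j => A i j - A ⟨0, hm⟩ j).bddBelow j
    linarith
  · obtain ⟨j, hj⟩ := hl ⟨0, hm⟩
    have h1 := hle i j
    have h2 := le_ciSup (Set.finite_range fun j => A i j - A ⟨0, hm⟩ j).bddAbove j
    linarith

open Finset in
/-- A lattice point of `s • tconv m A` is determined by the roots and left degrees of a spanning forest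
of its type graph together with its coordinates at the roots. -/
theorem ncard_dilate_tconv_le (m n : ℕ) (hm : 0 < m) (hn : 0 < n) (A : Fin m → Fin n → ℝ)
    (s : ℕ) (hs : 0 < s) (R : ℝ)
    (hR : ∀ i, (⨆ j, (A i j - A ⟨0, hm⟩ j)) - (⨅ j, (A i j - A ⟨0, hm⟩ j)) ≤ R) :
    (Set.ncard {w : Fin (m - 1) → ℤ | (fun i => (w i : ℝ)) ∈ (s : ℝ) • tconv m A} : ℝ) ≤
      ∑ S ∈ (univ.erase (⟨0, hm⟩ : Fin m)).powerset, if #S < tropRank m n A then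
        (((m - 1 + (n - 1 - #S)).choose (n - 1 - #S) : ℕ) : ℝ) * (1 + s * R) ^ #S else 0 := by
  classical
  set i₀ : Fin m := ⟨0, hm⟩ with hi₀
  have hs' : (s : ℝ) ≠ 0 := by positivity
  have hs'' : (0 : ℝ) ≤ s := by positivity
  have : Nonempty (Fin n) := ⟨⟨0, hn⟩⟩
  set lo : Fin m → ℝ := fun i => ⨅ j, (A i j - A i₀ j) with hlo
  set hi : Fin m → ℝ := fun i => ⨆ j, (A i j - A i₀ j) with hhi
  have hlohi : ∀ i, lo i ≤ hi i := fun i =>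
    ciInf_le_ciSup (Set.finite_range _).bddBelow (Set.finite_range _).bddAbove
  set W : Set (Fin (m - 1) → ℤ) :=
    {w | (fun i => (w i : ℝ)) ∈ (s : ℝ) • tconv m A} with hW
  have data : ∀ w ∈ W, _ := fun w hw =>
    tconv_point_data m n hm hn A ((s : ℝ)⁻¹ • fun i => (w i : ℝ))
      ((Set.mem_smul_set_iff_inv_smul_mem₀ hs' _ _).1 hw)
  choose! x a S L hx0 hxs hle hxlo hxhi h0 hSk hL1 hsum hb ha using data
  have hint : ∀ w ∈ W, ∀ i, ((⌊s * x w i⌋ : ℤ) : ℝ) = s * x w i := by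
    intro w hw i
    have : ∃ z : ℤ, s * x w i = z := by
      rcases i with ⟨_ | t, ht⟩
      · exact ⟨0, by rw [hx0 w hw]; simp⟩
      · refine ⟨w ⟨t, by omega⟩, ?_⟩
        have := hxs w hw ⟨t, by omega⟩
        simp only [Pi.smul_apply, smul_eq_mul] at this
        rw [this]
        field_simp
    obtain ⟨z, hz⟩ := this
    rw [hz, Int.floor_intCast]
  let T₁ : Finset (Fin m) → Finset (Fin m →₀ ℕ) := fun S =>
    if #S < tropRank m n A then finsuppAntidiag univ (n - 1 - #S) else ∅
  let T₂ : Finset (Fin m) → Finset (Fin m → ℤ) := fun S =>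
    Fintype.piFinset fun i => if i ∈ S then Icc ⌈s * lo i⌉ ⌊s * hi i⌋ else {0}
  let T := (univ.erase i₀).powerset.biUnion fun S => {S} ×ˢ (T₁ S ×ˢ T₂ S)
  let g : (Fin (m - 1) → ℤ) → Finset (Fin m) × (Fin m →₀ ℕ) × (Fin m → ℤ) := fun w =>
    ((S w).erase i₀, Finsupp.equivFunOnFinite.symm fun i => L w i - 1,
      fun i => if i ∈ (S w).erase i₀ then ⌊s * x w i⌋ else 0)
  have hg : ∀ w ∈ W, g w ∈ (T : Set _) := by
    intro w hw
    have hc : #((S w).erase i₀) + 1 = #(S w) := card_erase_add_one (h0 w hw)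
    refine mem_coe.2 (mem_biUnion.2 ⟨(S w).erase i₀,
      mem_powerset.2 (erase_subset_erase _ (subset_univ _)), ?_⟩)
    refine mem_product.2 ⟨mem_singleton.2 rfl, mem_product.2 ⟨?_, ?_⟩⟩
    · have := hSk w hw
      simp only [T₁, g]
      rw [if_pos (by omega)]
      simp only [mem_finsuppAntidiag, Finsupp.equivFunOnFinite_symm_apply_apply, subset_univ,
        and_true]
      have h1 : ∑ i, (L w i - 1) + m = ∑ i, L w i := by
        have : ∑ i : Fin m, (L w i - 1 + 1) = ∑ i, L w i :=
          sum_congr rfl fun i _ => Nat.sub_add_cancel (hL1 w hw i)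
        rw [← this, sum_add_distrib]; simp
      have := hsum w hw
      omega
    · refine Fintype.mem_piFinset.2 fun i => ?_
      simp only [g]
      split_ifs with hiS
      · refine mem_Icc.2 ⟨Int.ceil_le.2 ?_, Int.floor_le_floor ?_⟩
        · rw [hint w hw]
          exact mul_le_mul_of_nonneg_left (hxlo w hw i) hs''
        · exact mul_le_mul_of_nonneg_left (hxhi w hw i) hs''
      · exact mem_singleton_self _
  have hinj : Set.InjOn g W := by
    intro w hw w' hw' hgg
    simp only [g, Prod.mk.injEq] at hgg
    obtain ⟨e1, e2, e3⟩ := hgg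
    have eS : S w = S w' := by
      rw [← insert_erase (h0 w hw), ← insert_erase (h0 w' hw'), e1]
    have eL : L w = L w' := by
      have e2 := Finsupp.equivFunOnFinite.symm.injective e2
      funext i
      have := congrFun e2 i
      have := hL1 w hw i
      have := hL1 w' hw' i
      omega
    have ex : ∀ i ∈ S w, x w i = x w' i := by
      intro i hi
      by_cases hii : i = i₀
      · rw [hii, hx0 w hw, hx0 w' hw']
      · have := congrFun e3 i
        rw [← eS] at this
        simp only [mem_erase, ne_eq, hii, not_false_eq_true, hi, and_self, if_true] at this
        have h3 : (s : ℝ) * x w i = s * x w' i := by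
          rw [← hint w hw, ← hint w' hw', this]
        exact mul_left_cancel₀ hs' h3
    have exx : ∀ i, x w i = x w' i := fun i => le_antisymm
      (le_of_degrees_eq A _ _ _ _ (hle w hw) (hle w' hw') (S w) (L w) (hb w hw)
        (eL ▸ ha w' hw') ex i)
      (le_of_degrees_eq A _ _ _ _ (hle w' hw') (hle w hw) (S w) (L w)
        (eL ▸ eS ▸ hb w' hw') (ha w hw) (fun i hi => (ex i hi).symm) i)
    funext t
    have h1 := hxs w hw t
    have h2 := hxs w' hw' t
    rw [exx, h2] at h1
    simp only [Pi.smul_apply, smul_eq_mul] at h1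
    exact_mod_cast (mul_left_cancel₀ (inv_ne_zero hs') h1).symm
  have hcard : W.ncard ≤ #T := by
    rw [← Set.ncard_coe_finset]
    exact Set.ncard_le_ncard_of_injOn g hg hinj (finite_toSet T)
  refine (Nat.cast_le.2 (hcard.trans card_biUnion_le)).trans ?_
  rw [Nat.cast_sum]
  refine sum_le_sum fun S _ => ?_
  rw [card_product, card_singleton, one_mul, card_product]
  simp only [T₁, T₂]
  split_ifs with hSk
  · rw [card_finsuppAntidiag_nat_eq_choose, Nat.cast_mul, card_univ, Fintype.card_fin,
      Nat.sub_add_comm (Nat.succ_le_of_lt hm)]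
    refine mul_le_mul_of_nonneg_left ?_ (Nat.cast_nonneg _)
    rw [Fintype.card_piFinset, Nat.cast_prod, ← prod_subset (subset_univ S), ← prod_const]
    · refine prod_le_prod (fun _ _ => Nat.cast_nonneg _) fun i hi => ?_
      rw [if_pos hi]
      refine (card_Icc_ceil_floor_le (mul_le_mul_of_nonneg_left (hlohi i) hs'')).trans ?_
      rw [← mul_sub]
      gcongr
      exact hR i
    · intro i _ hi
      simp [hi]
  · simp

/-- Upper bound on the number of integer points of the dilated tropical polytope
`s·tconv(A)` in terms of the tropical rank `k` of `A`. -/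
theorem stmt14 (m n : ℕ) (hm : 2 ≤ m) (hn : 1 ≤ n) (A : Fin m → Fin n → ℤ)
    (k : ℕ) (hk : k = tropRank m n (fun i j => (A i j : ℝ)))
    (R : ℝ)
    (hRdef : R = ⨆ i : Fin m, ((⨆ j, ((A i j : ℝ) - (A ⟨0, by omega⟩ j : ℝ))) -
        ⨅ j, ((A i j : ℝ) - (A ⟨0, by omega⟩ j : ℝ))))
    (hR1 : 1 ≤ R) (s : ℕ) (hs : 0 < s) :
    (Set.ncard {w : Fin (m - 1) → ℤ | (fun i => (w i : ℝ)) ∈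
        (s : ℝ) • tconv m (fun i j => (A i j : ℝ))} : ℝ) ≤
      3 ^ (m + n - 2) *
        ((1 + 2 * (s : ℝ) * R * Real.sqrt ((m : ℝ) - 1)) ^ k - 1) /
          (2 * (s : ℝ) * R * Real.sqrt ((m : ℝ) - 1)) := by
  have hm0 : 0 < m := by omega
  have hR : ∀ i, (⨆ j, ((A i j : ℝ) - A ⟨0, hm0⟩ j)) - (⨅ j, ((A i j : ℝ) - A ⟨0, hm0⟩ j)) ≤ R :=
    fun i => hRdef ▸ le_ciSup (f := fun i => (⨆ j, ((A i j : ℝ) - A ⟨0, hm0⟩ j)) -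
      (⨅ j, ((A i j : ℝ) - A ⟨0, hm0⟩ j))) (Set.finite_range _).bddAbove i
  refine (ncard_dilate_tconv_le m n hm0 hn (fun i j => (A i j : ℝ)) s hs R hR).trans ?_
  rw [← hk]
  have hsq : 1 ≤ Real.sqrt ((m : ℝ) - 1) := by
    rw [Real.one_le_sqrt]
    have : (2 : ℝ) ≤ m := by exact_mod_cast hm
    linarith
  have hsR : 0 < (s : ℝ) * R := by positivity
  set Λ : ℝ := 2 * (s : ℝ) * R * Real.sqrt ((m : ℝ) - 1) with hΛ
  have hΛR : s * R ≤ Λ := by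
    have : s * R * 1 ≤ s * R * Real.sqrt ((m : ℝ) - 1) := by gcongr
    rw [hΛ]
    nlinarith
  have hΛ0 : 0 < Λ := hsR.trans_le hΛR
  rw [Finset.sum_powerset_apply_card (fun d => if d < k then
    (((m - 1 + (n - 1 - d)).choose (n - 1 - d) : ℕ) : ℝ) * (1 + s * R) ^ d else 0),
    Finset.card_erase_of_mem (Finset.mem_univ _), Finset.card_univ, Fintype.card_fin]
  have hterm : ∀ d, (m - 1).choose d • (if d < k then
      (((m - 1 + (n - 1 - d)).choose (n - 1 - d) : ℕ) : ℝ) * (1 + s * R) ^ d else 0) ≤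
      if d < k then 3 ^ (m + n - 2) * (1 + Λ) ^ d else 0 := by
    intro d
    split_ifs
    · rw [nsmul_eq_mul, ← mul_assoc, ← Nat.cast_mul]
      have h1 : (((m - 1).choose d * (m - 1 + (n - 1 - d)).choose (n - 1 - d) : ℕ) : ℝ) ≤
          3 ^ (m + n - 2) := by
        have := (choose_mul_choose_le_three_pow (m - 1) (n - 1 - d) d).trans
          (Nat.pow_le_pow_right (by norm_num) (show _ ≤ m + n - 2 by omega))
        exact_mod_cast this
      gcongr
    · simp
  refine (Finset.sum_le_sum fun d _ => hterm d).trans ?_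
  have hgeom : ∑ d ∈ Finset.range k, (1 + Λ) ^ d = ((1 + Λ) ^ k - 1) / Λ := by
    rw [geom_sum_eq (by linarith)]
    simp
  rw [mul_div_assoc, ← hgeom, Finset.mul_sum, ← Finset.sum_filter]
  refine Finset.sum_le_sum_of_subset_of_nonneg (fun d hd => ?_) fun d _ _ => by positivity
  simpa using (Finset.mem_filter.1 hd).2
end
end

section
/- Let A ∈ ℤ^{m×n} with m ≥ 2, let k be the tropical rank of A, and let s be a positive integer. Then the number of integer points in the dilated tropical polytope s·tconv(A) = {s·y : y ∈ tconv(A)} ⊆ ℝ^{m−1} satisfies |s·tconv(A) ∩ ℤ^{m−1}| ≥ (⌊s/k⌋ + 1)^k − ⌊s/k⌋^k. -/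
open MeasureTheory Pointwise

noncomputable section

/-- Integral duality for the assignment problem: if the identity is an optimal assignment for an
integer cost matrix, then there is an integral dual solution that is tight on the diagonal. -/
theorem exists_dual_of_diag_optimal {ι : Type*} [Fintype ι] [DecidableEq ι] (W : ι → ι → ℤ)
    (h : ∀ σ : Equiv.Perm ι, ∑ i, W i i ≤ ∑ i, W i (σ i)) :
    ∃ a b : ι → ℤ, (∀ i j, a i + b j ≤ W i j) ∧ ∀ i, a i + b i = W i i := by
  obtain ⟨z, ⟨a, b, hab, hz⟩, hmax⟩ := Int.exists_greatest_of_bdd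
    (P := fun z => ∃ a b : ι → ℤ, (∀ i j, a i + b j ≤ W i j) ∧ ∑ i, (a i + b i) = z)
    ⟨∑ i, W i i, by
      rintro z ⟨a, b, hab, rfl⟩
      exact Finset.sum_le_sum fun i _ => hab i i⟩
    ⟨_, fun i => -∑ j, |W i j|, 0, fun i j => by
      have h1 := Finset.single_le_sum (f := fun j => |W i j|) (fun j _ => abs_nonneg _)
        (Finset.mem_univ j)
      have h2 := neg_abs_le (W i j)
      simp only [Pi.zero_apply] at *
      linarith, rfl⟩
  let N : ι → Finset ι := fun i => {j | a i + b j = W i j}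
  have hall : ∀ S : Finset ι, S.card ≤ (S.biUnion N).card := by
    intro S
    by_contra! hlt
    have key := hmax _ ⟨fun i => a i + if i ∈ S then 1 else 0,
      fun j => b j - if j ∈ S.biUnion N then 1 else 0, fun i j => by
        have hij := hab i j
        by_cases hi : i ∈ S
        · by_cases hj : j ∈ S.biUnion N
          · simp only [hi, hj, if_true]; linarith
          · have hne : a i + b j ≠ W i j := fun he =>
              hj (Finset.mem_biUnion.2 ⟨i, hi, by simp [N, he]⟩)
            simp only [hi, hj, if_true, if_false]
            omega
        · simp only [hi, if_false]
          split_ifs <;> omega, rfl⟩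
    simp only [Finset.sum_add_distrib, Finset.sum_sub_distrib, Finset.sum_boole,
      Finset.filter_univ_mem, ← hz] at key
    omega
  obtain ⟨f, hf, hfN⟩ := (Finset.all_card_le_biUnion_card_iff_exists_injective N).1 hall
  let σ : Equiv.Perm ι := Equiv.ofBijective f (Finite.injective_iff_bijective.1 hf)
  have hσ : ∑ i, W i (σ i) = ∑ i, (a i + b i) := by
    rw [Finset.sum_add_distrib, ← Equiv.sum_comp σ b, ← Finset.sum_add_distrib]
    refine Finset.sum_congr rfl fun i _ => ?_
    have := hfN i
    simp only [N, Finset.mem_filter, Finset.mem_univ, true_and] at this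
    exact this.symm
  have heq : ∑ i, (a i + b i) = ∑ i, W i i :=
    le_antisymm (Finset.sum_le_sum fun i _ => hab i i) (hσ ▸ h σ)
  exact ⟨a, b, hab, fun i =>
    (Finset.sum_eq_sum_iff_of_le fun i _ => hab i i).1 heq i (Finset.mem_univ i)⟩

/-- The tropical rank is attained by a submatrix whose diagonal is the unique optimal
assignment. -/
theorem exists_submatrix_tropRank {m n : ℕ} (A : Fin m → Fin n → ℤ) {k : ℕ}
    (hk : k = tropRank m n fun i j => (A i j : ℝ)) :
    ∃ (r : Fin k → Fin m) (c : Fin k → Fin n), ∀ τ : Equiv.Perm (Fin k), τ ≠ 1 →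
      ∑ i, A (r i) (c i) < ∑ i, A (r i) (c (τ i)) := by
  obtain ⟨r, c, -, -, σ, hσ, huniq⟩ : k ∈
      {k : ℕ | ∃ r : Fin k → Fin m, ∃ c : Fin k → Fin n,
        Function.Injective r ∧ Function.Injective c ∧
        TropNonsingular (fun i j => (A (r i) (c j) : ℝ))} := by
    rw [hk]
    refine Nat.sSup_mem ⟨0, Fin.elim0, Fin.elim0, fun i => i.elim0, fun i => i.elim0, 1,
      by simp, fun τ _ => Subsingleton.elim _ _⟩ ⟨m, ?_⟩
    rintro k ⟨r, c, hr, -⟩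
    simpa using Fintype.card_le_of_injective r hr
  refine ⟨r, c ∘ σ, fun τ hτ => ?_⟩
  by_contra! hle
  refine hτ ?_
  have h1 : σ * τ = σ := huniq _ fun ρ => by
    refine le_trans ?_ (hσ ρ)
    have : ((∑ i, A (r i) ((c ∘ σ) (τ i)) : ℤ) : ℝ) ≤ ((∑ i, A (r i) ((c ∘ σ) i) : ℤ) : ℝ) :=
      Int.cast_le.2 hle
    push_cast at this
    simpa using this
  simpa using h1

/-- A submatrix with uniquely optimal diagonal has, after scaling by `s`, an integral dual
solution with slack `s / k` off the diagonal. -/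
theorem exists_dual_with_slack {k : ℕ} (M : Fin k → Fin k → ℤ) (s : ℕ)
    (hM : ∀ τ : Equiv.Perm (Fin k), τ ≠ 1 → ∑ i, M i i < ∑ i, M i (τ i)) :
    ∃ a b : Fin k → ℤ, (∀ i, a i + b i = s * M i i) ∧
      ∀ i j, i ≠ j → a i + b j + (s / k : ℕ) ≤ s * M i j := by
  obtain ⟨a, b, hab, hd⟩ := exists_dual_of_diag_optimal
    (fun i j => s * M i j - if i = j then 0 else ((s / k : ℕ) : ℤ)) (fun σ => by
      by_cases hσ : σ = 1
      · simp [hσ]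
      · have h1 := hM σ hσ
        have h2 : ∑ i, (if i = σ i then 0 else ((s / k : ℕ) : ℤ)) ≤ s := by
          calc _ ≤ ∑ _i : Fin k, ((s / k : ℕ) : ℤ) :=
                Finset.sum_le_sum fun i _ => by
                  split_ifs
                  exacts [Int.natCast_nonneg _, le_rfl]
            _ = ((k * (s / k) : ℕ) : ℤ) := by simp
            _ ≤ s := by exact_mod_cast Nat.mul_div_le s k
        simp only [if_true, sub_zero, Finset.sum_sub_distrib, ← Finset.mul_sum]
        nlinarith)
  refine ⟨a, b, fun i => by simpa using hd i, fun i j hij => ?_⟩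
  have := hab i j
  simp only [hij, if_false] at this
  linarith

/-- Integer lattice points of `s • tconv m A` form a finite set. -/
theorem finite_lattice_points_smul_tconv (m n : ℕ) (hn : 1 ≤ n) (A : Fin m → Fin n → ℤ) (s : ℕ) :
    {w : Fin (m - 1) → ℤ | (fun i => (w i : ℝ)) ∈
        (s : ℝ) • tconv m (fun i j => (A i j : ℝ))}.Finite := by
  have : Nonempty (Fin n) := ⟨⟨0, hn⟩⟩
  let C : ℤ := ∑ i, ∑ j, |A i j|
  have hC : ∀ i j, |(A i j : ℝ)| ≤ C := fun i j => by
    have h1 := Finset.single_le_sum (f := fun j => |A i j|) (fun j _ => abs_nonneg _)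
      (Finset.mem_univ j)
    have h2 := Finset.single_le_sum (f := fun i => ∑ j, |A i j|)
      (fun i _ => Finset.sum_nonneg fun j _ => abs_nonneg _) (Finset.mem_univ i)
    exact_mod_cast h1.trans h2
  have hcmp : ∀ (α : Fin n → ℝ) (p q : Fin m),
      (⨅ j, (α j + (A p j : ℝ))) - (⨅ j, (α j + (A q j : ℝ))) ≤ 2 * C := by
    intro α p q
    suffices h : (⨅ j, (α j + (A p j : ℝ))) - 2 * C ≤ ⨅ j, (α j + (A q j : ℝ)) by linarith
    refine le_ciInf fun j => ?_
    have h1 : (⨅ j, (α j + (A p j : ℝ))) ≤ α j + A p j := ciInf_le (Set.finite_range _).bddBelow j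
    have h2 := abs_le.1 (hC p j)
    have h3 := abs_le.1 (hC q j)
    linarith
  refine (Set.finite_Icc (fun _ => -(s * (2 * C)) : Fin (m - 1) → ℤ) fun _ => s * (2 * C)).subset ?_
  rintro w ⟨y, ⟨α, hα⟩, hw⟩
  have hwk : ∀ i, (w i : ℝ) = s * y i := fun i => by simpa using (congrFun hw i).symm
  have hs : (0 : ℝ) ≤ s := Nat.cast_nonneg s
  constructor <;> intro i
  · have h1 := mul_le_mul_of_nonneg_left (hcmp α ⟨0, by have := i.isLt; omega⟩
      ⟨(i : ℕ) + 1, by have := i.isLt; omega⟩) hs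
    have h2 := hwk i
    rw [hα i] at h2
    have : (-(s * (2 * C)) : ℝ) ≤ w i := by rw [h2]; linarith
    exact_mod_cast this
  · have h1 := mul_le_mul_of_nonneg_left (hcmp α ⟨(i : ℕ) + 1, by have := i.isLt; omega⟩
      ⟨0, by have := i.isLt; omega⟩) hs
    have h2 := hwk i
    rw [hα i] at h2
    have : (w i : ℝ) ≤ s * (2 * C) := by rw [h2]; linarith
    exact_mod_cast this

/-- Integer coefficients on the scaled matrix `s • A` give lattice points of `s • tconv m A`. -/
theorem lattice_point_mem_smul_tconv {m n : ℕ} (A : Fin m → Fin n → ℤ) {s : ℕ} (hs : 0 < s)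
    (β : Fin n → ℤ) (x : Fin m → ℤ)
    (hle : ∀ p j, x p ≤ β j + s * A p j) (hex : ∀ p, ∃ j, x p = β j + s * A p j)
    (w : Fin (m - 1) → ℤ)
    (hw : ∀ i : Fin (m - 1), w i = x ⟨(i : ℕ) + 1, by have := i.isLt; omega⟩
      - x ⟨0, by have := i.isLt; omega⟩) :
    (fun i => (w i : ℝ)) ∈ (s : ℝ) • tconv m (fun i j => (A i j : ℝ)) := by
  have hs' : (0 : ℝ) < s := Nat.cast_pos.2 hs
  have hinf : ∀ p, (⨅ j, ((β j : ℝ) / s + (A p j : ℝ))) = x p / s := by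
    intro p
    obtain ⟨j₀, hj₀⟩ := hex p
    have : Nonempty (Fin n) := ⟨j₀⟩
    refine le_antisymm ?_ (le_ciInf fun j => ?_)
    · refine (ciInf_le (Set.finite_range _).bddBelow j₀).trans (le_of_eq ?_)
      rw [hj₀]
      push_cast
      field_simp
    · have : (x p : ℝ) ≤ β j + s * A p j := by exact_mod_cast hle p j
      rw [div_le_iff₀ hs', add_mul, div_mul_cancel₀ _ hs'.ne']
      linarith
  refine ⟨fun i => (w i : ℝ) / s, ⟨fun j => (β j : ℝ) / s, fun i => ?_⟩, ?_⟩
  · simp only [hinf, hw]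
    push_cast
    ring
  · funext i
    simp only [Pi.smul_apply, smul_eq_mul]
    field_simp

/-- Prescribing values on the chosen rows: if `x` satisfies the inequalities making the column
`c i` active in row `r i`, some integer tropical combination of the columns of `s • A` has
value `x i` in row `r i`. -/
theorem exists_tropical_combination {m n k : ℕ} (hk : 0 < k) (hn : 1 ≤ n)
    (A : Fin m → Fin n → ℤ) (s : ℕ) (r : Fin k → Fin m) (c : Fin k → Fin n) (x : Fin k → ℤ)
    (hx : ∀ i i', x i' - s * A (r i') (c i) ≤ x i - s * A (r i) (c i)) :
    ∃ (β : Fin n → ℤ) (X : Fin m → ℤ), (∀ p j, X p ≤ β j + s * A p j) ∧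
      (∀ p, ∃ j, X p = β j + s * A p j) ∧ ∀ i, X (r i) = x i := by
  have : Nonempty (Fin n) := ⟨⟨0, hn⟩⟩
  have : Nonempty (Fin k) := ⟨⟨0, hk⟩⟩
  have hβ : ∀ j, ∃ i₀, ∀ i, x i - s * A (r i) j ≤ x i₀ - s * A (r i₀) j := fun j =>
    Finite.exists_max fun i => x i - s * A (r i) j
  choose g hg using hβ
  have hX : ∀ p, ∃ j₀, ∀ j, (x (g j₀) - s * A (r (g j₀)) j₀) + s * A p j₀ ≤
      (x (g j) - s * A (r (g j)) j) + s * A p j := fun p =>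
    Finite.exists_min fun j => (x (g j) - s * A (r (g j)) j) + s * A p j
  choose f hf using hX
  refine ⟨fun j => x (g j) - s * A (r (g j)) j,
    fun p => (x (g (f p)) - s * A (r (g (f p))) (f p)) + s * A p (f p), hf,
    fun p => ⟨f p, rfl⟩, fun i => le_antisymm ?_ ?_⟩
  · have h1 := hf (r i) (c i)
    have h2 := hx i (g (c i))
    linarith
  · have := hg (f (r i)) i
    linarith

/-- Lower bound on the number of integer points of the dilated tropical polytope
`s·tconv(A)`: at least `(⌊s/k⌋+1)^k − ⌊s/k⌋^k`, where `k` is the tropical rank. -/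
theorem stmt15 (m n : ℕ) (hm : 2 ≤ m) (hn : 1 ≤ n) (A : Fin m → Fin n → ℤ)
    (k : ℕ) (hk : k = tropRank m n (fun i j => (A i j : ℝ)))
    (s : ℕ) (hs : 0 < s) :
    (s / k + 1) ^ k - (s / k) ^ k ≤
      Set.ncard {w : Fin (m - 1) → ℤ | (fun i => (w i : ℝ)) ∈
        (s : ℝ) • tconv m (fun i j => (A i j : ℝ))} := by
  rcases Nat.eq_zero_or_pos k with rfl | hkpos
  · simp
  obtain ⟨r, c, hrc⟩ := exists_submatrix_tropRank A hk
  obtain ⟨a, b, hab, hslack⟩ := exists_dual_with_slack (fun i j => A (r i) (c j)) s hrc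
  generalize s / k = q at hslack ⊢
  have hcomb : ∀ t : Fin k → ℕ, (∀ i, t i ≤ q) → ∃ (β : Fin n → ℤ) (X : Fin m → ℤ),
      (∀ p j, X p ≤ β j + s * A p j) ∧ (∀ p, ∃ j, X p = β j + s * A p j) ∧
      ∀ i, X (r i) = a i + t i := fun t ht =>
    exists_tropical_combination hkpos hn A s r c (fun i => a i + t i) fun i i' => by
      by_cases hii : i' = i
      · rw [hii]
      · have h1 := hslack i' i hii
        have h2 := hab i
        have h3 : (t i' : ℤ) ≤ q := Int.ofNat_le.2 (ht i')
        linarith [Int.natCast_nonneg (t i)]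
  choose! β X hle hex hXr using hcomb
  let w : (Fin k → ℕ) → Fin (m - 1) → ℤ := fun t i =>
    X t ⟨(i : ℕ) + 1, by have := i.isLt; omega⟩ - X t ⟨0, by omega⟩
  let T : Finset (Fin k → ℕ) := Fintype.piFinset (fun _ => Finset.range (q + 1)) \
    Fintype.piFinset (fun _ => Finset.Icc 1 q)
  have hT : T.card = (q + 1) ^ k - q ^ k := by
    rw [Finset.card_sdiff_of_subset]
    · simp
    · refine Fintype.piFinset_subset _ _ fun _ j hj => ?_
      simp only [Finset.mem_Icc, Finset.mem_range] at *
      omega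
  have hmem : ∀ t ∈ T, (∀ i, t i ≤ q) ∧ ∃ i, t i = 0 := by
    intro t ht
    simp only [T, Finset.mem_sdiff, Fintype.mem_piFinset, Finset.mem_range, Finset.mem_Icc,
      Nat.lt_succ_iff, not_forall] at ht
    obtain ⟨h1, i, hi⟩ := ht
    exact ⟨h1, i, by have := h1 i; omega⟩
  rw [← hT, ← Set.ncard_coe_finset]
  refine Set.ncard_le_ncard_of_injOn w (fun t ht => ?_) (fun t ht t' ht' hww => ?_)
    (finite_lattice_points_smul_tconv m n hn A s)
  · have ht := (hmem t ht).1
    exact lattice_point_mem_smul_tconv A hs (β t) (X t) (hle t ht) (hex t ht) _ fun _ => rfl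
  · obtain ⟨ht, i₀, hi₀⟩ := hmem t ht
    obtain ⟨ht', i₁, hi₁⟩ := hmem t' ht'
    have hdiff : ∀ p : Fin m, X t p - X t ⟨0, by omega⟩ = X t' p - X t' ⟨0, by omega⟩ := by
      rintro ⟨_ | p, hp⟩
      · simp
      · exact congrFun hww ⟨p, by omega⟩
    have hrow : ∀ i, (t i : ℤ) - X t ⟨0, by omega⟩ = t' i - X t' ⟨0, by omega⟩ := fun i => by
      have h1 := hdiff (r i)
      rw [hXr t ht, hXr t' ht'] at h1
      linarith
    funext i
    have h0 := hrow i₀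
    have h1 := hrow i₁
    have h2 := hrow i
    omega
end
end

section
/- Let n ≥ 1 and let C_1, …, C_r be subsets of {1,…,n}, each of cardinality 2 (the clauses of a monotone 2-SAT formula). Let L > 0 be real and define P = {x ∈ ℝ^n : −L ≤ x_i ≤ 0 for all i, and min_{i ∈ C_j} x_i ≤ −L/2 for all j = 1,…,r}. Let N be the number of subsets T ⊆ {1,…,n} such that T ∩ C_j ≠ ∅ for every j (the number of satisfying assignments of the formula). Then the Lebesgue measure of P in ℝ^n equals N · (L/2)^n. -/
open MeasureTheory

/-- The box of points of `[-L, 0]^ι` whose coordinates at most `-L / 2` are exactly those in `T`. -/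
def halfBox {ι : Type*} [DecidableEq ι] (L : ℝ) (T : Finset ι) : Set (ι → ℝ) :=
  Set.univ.pi fun i => if i ∈ T then Set.Icc (-L) (-L / 2) else Set.Ioc (-L / 2) 0

section halfBox

variable {ι : Type*} [DecidableEq ι]

theorem mem_halfBox_iff [Fintype ι] {L : ℝ} (hL : 0 < L) {T : Finset ι} {x : ι → ℝ} :
    x ∈ halfBox L T ↔
      (∀ i, -L ≤ x i ∧ x i ≤ 0) ∧ T = Finset.univ.filter fun i => x i ≤ -L / 2 := by
  simp only [halfBox, Set.mem_univ_pi, Finset.ext_iff, Finset.mem_filter, Finset.mem_univ,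
    true_and, ← forall_and]
  refine forall_congr' fun i => ?_
  split_ifs with hi
  · simp only [Set.mem_Icc, hi, true_iff]
    constructor
    · rintro ⟨h₁, h₂⟩
      exact ⟨⟨h₁, by linarith⟩, h₂⟩
    · rintro ⟨⟨h₁, -⟩, h₂⟩
      exact ⟨h₁, h₂⟩
  · simp only [Set.mem_Ioc, hi, false_iff, not_le]
    constructor
    · rintro ⟨h₁, h₂⟩
      exact ⟨⟨by linarith, h₂⟩, h₁⟩
    · rintro ⟨⟨-, h₁⟩, h₂⟩
      exact ⟨h₂, h₁⟩

theorem measurableSet_halfBox [Countable ι] (L : ℝ) (T : Finset ι) :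
    MeasurableSet (halfBox L T) := by
  refine MeasurableSet.univ_pi fun i => ?_
  split_ifs
  exacts [measurableSet_Icc, measurableSet_Ioc]

theorem volume_halfBox [Fintype ι] (L : ℝ) (T : Finset ι) :
    volume (halfBox L T) = ENNReal.ofReal (L / 2) ^ Fintype.card ι := by
  rw [halfBox, volume_pi_pi, ← Finset.card_univ]
  refine Finset.prod_eq_pow_card fun i _ => ?_
  split_ifs
  · rw [Real.volume_Icc]
    congr 1
    ring
  · rw [Real.volume_Ioc]
    congr 1
    ring

theorem pairwise_disjoint_halfBox [Fintype ι] {L : ℝ} (hL : 0 < L) :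
    Pairwise fun S T : Finset ι => Disjoint (halfBox L S) (halfBox L T) := by
  intro S T hST
  refine Set.disjoint_left.2 fun x hS hT => hST ?_
  rw [((mem_halfBox_iff hL).1 hS).2, ((mem_halfBox_iff hL).1 hT).2]

end halfBox

/-- The volume of the tropical polytope
`P = {x ∈ ℝ^n : −L ≤ x_i ≤ 0, min_{i ∈ C_j} x_i ≤ −L/2}` associated to a monotone
2-SAT formula with clauses `C_1, …, C_r` equals `N·(L/2)^n`, where `N` is the number
of satisfying assignments. -/
theorem stmt16 (n r : ℕ) (hn : 1 ≤ n) (C : Fin r → Finset (Fin n))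
    (hC : ∀ j, (C j).card = 2) (L : ℝ) (hL : 0 < L) :
    volume {x : Fin n → ℝ |
        (∀ i, -L ≤ x i ∧ x i ≤ 0) ∧ ∀ j, ∃ i ∈ C j, x i ≤ -L / 2} =
      ENNReal.ofReal
        (((Finset.univ.filter fun T : Finset (Fin n) =>
            ∀ j, (T ∩ C j).Nonempty).card : ℝ) * (L / 2) ^ n) := by
  have hP : {x : Fin n → ℝ | (∀ i, -L ≤ x i ∧ x i ≤ 0) ∧ ∀ j, ∃ i ∈ C j, x i ≤ -L / 2} =
      ⋃ T ∈ Finset.univ.filter fun T : Finset (Fin n) => ∀ j, (T ∩ C j).Nonempty,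
        halfBox L T := by
    ext x
    simp only [Set.mem_ofPred_eq, Set.mem_iUnion, exists_prop, mem_halfBox_iff hL,
      Finset.mem_filter, Finset.mem_univ, true_and, Finset.Nonempty, Finset.mem_inter]
    constructor
    · rintro ⟨hx, h⟩
      refine ⟨_, fun j => ?_, hx, rfl⟩
      obtain ⟨i, hi, hxi⟩ := h j
      exact ⟨i, by simpa using hxi, hi⟩
    · rintro ⟨T, hT, hx, rfl⟩
      refine ⟨hx, fun j => ?_⟩
      obtain ⟨i, hxi, hi⟩ := hT j
      exact ⟨i, hi, by simpa using hxi⟩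
  rw [hP, measure_biUnion_finset (fun S _ T _ h => pairwise_disjoint_halfBox hL h)
    fun T _ => measurableSet_halfBox L T]
  simp only [volume_halfBox, Finset.sum_const, Fintype.card_fin, nsmul_eq_mul]
  rw [ENNReal.ofReal_mul (Nat.cast_nonneg _), ENNReal.ofReal_natCast,
    ENNReal.ofReal_pow (by positivity)]
end

section
/- Let A ∈ ℚ^{m×n} with m ≥ 2. Then the Lebesgue measure of the tropical polytope tconv(A) ⊆ ℝ^{m−1} is strictly positive if and only if the tropical rank of A equals m (the maximum possible value); equivalently, tconv(A) has Lebesgue measure zero if and only if A does not have maximum tropical rank. -/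
open MeasureTheory Pointwise

noncomputable section

/-- If every non-identity permutation has positive weight, then a nonnegative circulation of
nonpositive weight vanishes. -/
lemma circulation_eq_zero {V : Type*} [Fintype V] [DecidableEq V] (w μ : V → V → ℝ)
    (hd : ∀ i, w i i = 0) (hw : ∀ σ : Equiv.Perm V, σ ≠ 1 → 0 < ∑ i, w i (σ i))
    (hμ : ∀ i j, 0 ≤ μ i j) (hμd : ∀ i, μ i i = 0) (hcirc : ∀ k, ∑ j, μ k j = ∑ i, μ i k)
    (hcost : ∑ i, ∑ j, μ i j * w i j ≤ 0) (i j : V) : μ i j = 0 := by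
  set s : V → ℝ := fun k => ∑ j, μ k j with hs
  have hs0 : ∀ k, 0 ≤ s k := fun k => Finset.sum_nonneg fun j _ => hμ k j
  set S : ℝ := 1 + ∑ k, s k with hS
  have hsS : ∀ k, s k ≤ S := fun k => by
    have := Finset.single_le_sum (fun k _ => hs0 k) (Finset.mem_univ k)
    linarith
  have hSpos : 0 < S := by
    have := Finset.sum_nonneg (fun k (_ : k ∈ Finset.univ) => hs0 k)
    linarith
  set P : Matrix V V ℝ := fun i j => (μ i j + if i = j then S - s i else 0) / S with hP
  have hPds : P ∈ doublyStochastic ℝ V := by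
    rw [mem_doublyStochastic_iff_sum]
    refine ⟨fun i j => ?_, fun i => ?_, fun j => ?_⟩
    · refine div_nonneg (add_nonneg (hμ i j) ?_) hSpos.le
      split_ifs
      · linarith [hsS i]
      · exact le_rfl
    · simp only [hP]
      rw [← Finset.sum_div, Finset.sum_add_distrib]
      simp only [Finset.sum_ite_eq, Finset.mem_univ, if_true]
      rw [div_eq_one_iff_eq hSpos.ne']
      change s i + _ = _
      ring
    · simp only [hP]
      rw [← Finset.sum_div, Finset.sum_add_distrib, ← hcirc j]
      simp only [Finset.sum_ite_eq', Finset.mem_univ, if_true]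
      rw [div_eq_one_iff_eq hSpos.ne']
      change s j + _ = _
      ring
  obtain ⟨c, hc0, -, hcP⟩ := exists_eq_sum_perm_of_mem_doublyStochastic hPds
  have hPe : ∀ i j, P i j = ∑ σ : Equiv.Perm V, c σ * if σ i = j then 1 else 0 := fun i j => by
    rw [← hcP]
    simp [Matrix.sum_apply, PEquiv.toMatrix_apply, eq_comm]
  have hPw : ∑ i, ∑ j, P i j * w i j ≤ 0 := by
    have : ∑ i, ∑ j, P i j * w i j = (∑ i, ∑ j, μ i j * w i j) / S := by
      rw [Finset.sum_div]
      refine Finset.sum_congr rfl fun i _ => ?_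
      rw [Finset.sum_div]
      refine Finset.sum_congr rfl fun j _ => ?_
      simp only [hP]
      split_ifs with h
      · subst h
        simp [hd]
      · ring
    rw [this]
    exact div_nonpos_of_nonpos_of_nonneg hcost hSpos.le
  have hsum : ∑ i, ∑ j, P i j * w i j = ∑ σ : Equiv.Perm V, c σ * ∑ i, w i (σ i) := by
    simp only [hPe, Finset.sum_mul, Finset.mul_sum]
    calc _ = ∑ i, ∑ σ : Equiv.Perm V, ∑ j, (c σ * if σ i = j then 1 else 0) * w i j :=
          Finset.sum_congr rfl fun i _ => Finset.sum_comm
      _ = ∑ i, ∑ σ : Equiv.Perm V, c σ * w i (σ i) := by simp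
      _ = _ := Finset.sum_comm
  have hterm : ∀ σ : Equiv.Perm V, 0 ≤ c σ * ∑ i, w i (σ i) := fun σ => by
    refine mul_nonneg (hc0 σ) ?_
    by_cases h : σ = 1
    · simp [h, hd]
    · exact (hw σ h).le
  have hzero : ∀ σ : Equiv.Perm V, σ ≠ 1 → c σ = 0 := fun σ hσ => by
    have h0 : ∑ σ : Equiv.Perm V, c σ * ∑ i, w i (σ i) = 0 :=
      le_antisymm (hsum ▸ hPw) (Finset.sum_nonneg fun σ _ => hterm σ)
    have := (Finset.sum_eq_zero_iff_of_nonneg fun σ _ => hterm σ).1 h0 σ (Finset.mem_univ σ)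
    exact (mul_eq_zero.1 this).resolve_right (hw σ hσ).ne'
  by_cases hij : i = j
  · rw [hij, hμd]
  · have h1 : P i j = 0 := by
      rw [hPe]
      refine Finset.sum_eq_zero fun σ _ => ?_
      by_cases h : σ = 1
      · simp [h, hij]
      · simp [hzero σ h]
    simp only [hP, if_neg hij, add_zero] at h1
    exact (div_eq_zero_iff.1 h1).resolve_right hSpos.ne'

lemma nonneg_of_forall_lt_add_mul {a b c : ℝ} (h : ∀ t : ℝ, 0 ≤ t → c < a + t * b) : 0 ≤ b := by
  by_contra! hb
  have h1 := h ((|c - a|) / -b) (div_nonneg (abs_nonneg _) (by linarith))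
  have h2 : |c - a| / -b * b = -|c - a| := by
    rw [div_mul_eq_mul_div, div_neg, mul_div_cancel_right₀ _ hb.ne]
  have := neg_abs_le (c - a)
  linarith

/-- If every non-identity permutation has positive weight, then there is a strictly feasible
potential. -/
lemma exists_potential_s19 {V : Type*} [Fintype V] [DecidableEq V] (w : V → V → ℝ)
    (hd : ∀ i, w i i = 0) (hw : ∀ σ : Equiv.Perm V, σ ≠ 1 → 0 < ∑ i, w i (σ i)) :
    ∃ α : V → ℝ, ∀ i j, i ≠ j → α i - α j < w i j := by
  by_contra hno
  set C : Set (V × V → ℝ) := {v | ∃ α : V → ℝ, ∀ i j, i ≠ j → α i - α j < v (i, j)} with hC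
  have hCopen : IsOpen C := by
    have : C = ⋃ α : V → ℝ, ⋂ i, ⋂ j, ⋂ (_ : i ≠ j), {v | α i - α j < v (i, j)} := by
      ext v
      simp [hC]
    rw [this]
    refine isOpen_iUnion fun α => isOpen_iInter_of_finite fun i => isOpen_iInter_of_finite
      fun j => isOpen_iInter_of_finite fun _ => ?_
    exact isOpen_lt continuous_const (continuous_apply _)
  have hCconv : Convex ℝ C := by
    rintro v ⟨α, hα⟩ v' ⟨α', hα'⟩ a b ha hb hab
    refine ⟨fun i => a * α i + b * α' i, fun i j hij => ?_⟩
    have h1 := hα i j hij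
    have h2 := hα' i j hij
    simp only [Pi.add_apply, Pi.smul_apply, smul_eq_mul]
    rcases ha.eq_or_lt with rfl | ha'
    · have : b = 1 := by linarith
      subst this
      linarith
    · nlinarith [mul_lt_mul_of_pos_left h1 ha', mul_le_mul_of_nonneg_left h2.le hb]
  obtain ⟨f, hf⟩ := geometric_hahn_banach_open_point (x := fun p : V × V => w p.1 p.2)
    hCconv hCopen hno
  set μ : V → V → ℝ := fun i j => -f (Pi.single (i, j) 1) with hμdef
  have hfμ : ∀ v : V × V → ℝ, f v = -∑ i, ∑ j, μ i j * v (i, j) := fun v => by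
    have := LinearMap.pi_apply_eq_sum_univ (f : (V × V → ℝ) →ₗ[ℝ] ℝ) v
    rw [Fintype.sum_prod_type] at this
    rw [ContinuousLinearMap.coe_coe] at this
    rw [this, ← Finset.sum_neg_distrib]
    refine Finset.sum_congr rfl fun i _ => ?_
    rw [← Finset.sum_neg_distrib]
    refine Finset.sum_congr rfl fun j _ => ?_
    have h : (fun q : V × V => if (i, j) = q then (1 : ℝ) else 0) = Pi.single (i, j) 1 := by
      ext q
      simp [Pi.single_apply, eq_comm]
    rw [h]
    simp [hμdef, mul_comm]
  have hray : ∀ d : V × V → ℝ, (∀ t : ℝ, 0 ≤ t → (1 + t • d) ∈ C) → f d ≤ 0 := fun d h => by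
    have : 0 ≤ -f d := nonneg_of_forall_lt_add_mul (a := -f 1)
      (c := -f fun p : V × V => w p.1 p.2) fun t ht => by
        have := hf _ (h t ht)
        rw [map_add, map_smul, smul_eq_mul] at this
        linarith
    linarith
  have hμ : ∀ i j, 0 ≤ μ i j := fun i j => by
    refine neg_nonneg.2 (hray _ fun t ht => ⟨0, fun k l _ => ?_⟩)
    have : (0 : ℝ) ≤ (Pi.single (i, j) 1 : V × V → ℝ) (k, l) := by
      rw [Pi.single_apply]
      split_ifs <;> norm_num
    simp only [Pi.add_apply, Pi.smul_apply, Pi.one_apply, smul_eq_mul, Pi.zero_apply]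
    nlinarith [mul_nonneg ht this]
  have hμd : ∀ i, μ i i = 0 := fun i => by
    refine le_antisymm ?_ (hμ i i)
    have : f (-Pi.single (i, i) 1) ≤ 0 := hray _ fun t ht => ⟨0, fun k l hkl => by
      have : (k, l) ≠ (i, i) := fun h => by
        obtain ⟨rfl, rfl⟩ := Prod.mk.inj h
        exact hkl rfl
      simp [this]⟩
    rw [map_neg] at this
    exact this
  have hcirc : ∀ k, ∑ j, μ k j = ∑ i, μ i k := fun k => by
    have key : ∀ α : V → ℝ, f (fun p => α p.1 - α p.2) ≤ 0 := fun α =>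
      hray _ fun t ht => ⟨fun i => t * α i, fun i j _ => by
        simp only [Pi.add_apply, Pi.smul_apply, Pi.one_apply, smul_eq_mul]
        linarith⟩
    have hval : ∀ r : ℝ, f (fun p => (Pi.single k r : V → ℝ) p.1 - (Pi.single k r : V → ℝ) p.2)
        = -(r * (∑ j, μ k j - ∑ i, μ i k)) := fun r => by
      rw [hfμ]
      simp only [mul_sub, Finset.sum_sub_distrib, Pi.single_apply, mul_ite, mul_zero]
      rw [Finset.sum_comm]
      simp [Finset.mul_sum, mul_comm]
    have h1 := key (Pi.single k 1)
    have h2 := key (Pi.single k (-1))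
    rw [hval] at h1 h2
    linarith
  have hcost : ∑ i, ∑ j, μ i j * w i j ≤ 0 := by
    have h : 0 ≤ f fun p : V × V => w p.1 p.2 := by
      refine le_of_forall_pos_lt_add fun ε hε => ?_
      have hpos : 0 < ε / (1 + |f 1|) := by positivity
      have h1 := hf ((ε / (1 + |f 1|)) • 1) ⟨0, fun i j _ => by simpa using hpos⟩
      rw [map_smul, smul_eq_mul] at h1
      have h2 : -ε < ε / (1 + |f 1|) * f 1 := by
        rw [div_mul_eq_mul_div, lt_div_iff₀ (by positivity)]
        nlinarith [neg_abs_le (f 1)]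
      linarith
    rw [hfμ] at h
    linarith
  have hzero := circulation_eq_zero w μ hd hw hμ hμd hcirc hcost
  have := hf 1 ⟨0, fun i j _ => by simp⟩
  rw [hfμ, hfμ] at this
  simp [hzero] at this

/-- The columns `g a` of `A` witness that every coordinate of `x` is the unique entry at which
the column is tight. -/
def IsStrictlyTight {p n : ℕ} (A : Fin p → Fin n → ℝ) (x : Fin p → ℝ) (g : Fin p → Fin n) : Prop :=
  ∀ a b, b ≠ a → x b - A b (g a) < x a - A a (g a)

lemma tropNonsingular_of_isStrictlyTight {p n : ℕ} {A : Fin p → Fin n → ℝ} {x : Fin p → ℝ}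
    {g : Fin p → Fin n} (h : IsStrictlyTight A x g) : TropNonsingular fun i j => A i (g j) := by
  have key : ∀ τ : Equiv.Perm (Fin p), τ ≠ 1 → ∑ i, A i (g i) < ∑ i, A i (g (τ i)) := by
    intro τ hτ
    have h1 : ∑ i, (A (τ i) (g (τ i)) - x (τ i)) < ∑ i, (A i (g (τ i)) - x i) := by
      refine Finset.sum_lt_sum (fun i _ => ?_) ?_
      · by_cases hi : i = τ i
        · rw [← hi]
        · linarith [h (τ i) i hi]
      · obtain ⟨i, hi⟩ : ∃ i, τ i ≠ i := by
          by_contra! hc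
          exact hτ (Equiv.ext hc)
        exact ⟨i, Finset.mem_univ _, by linarith [h (τ i) i hi.symm]⟩
    rw [Equiv.sum_comp τ (fun i => A i (g i) - x i)] at h1
    simp only [Finset.sum_sub_distrib] at h1
    linarith
  refine ⟨1, fun τ => ?_, fun σ hσ => ?_⟩
  · by_cases hτ : τ = 1
    · rw [hτ]
    · exact (key τ hτ).le
  · by_contra hne
    exact absurd (hσ 1) (not_le.2 (key σ hne))

lemma exists_isStrictlyTight_of_tropNonsingular {p n : ℕ} {A : Fin p → Fin n → ℝ}
    {r : Fin p → Fin p} {c : Fin p → Fin n} (hr : Function.Injective r)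
    (h : TropNonsingular fun i j => A (r i) (c j)) : ∃ x g, IsStrictlyTight A x g := by
  obtain ⟨σ₀, hmin, huniq⟩ := h
  have hpos : ∀ σ : Equiv.Perm (Fin p), σ ≠ 1 →
      0 < ∑ i, (A (r i) (c (σ₀ (σ i))) - A (r i) (c (σ₀ i))) := by
    intro σ hσ
    rw [Finset.sum_sub_distrib, sub_pos]
    by_contra! hle
    have := huniq (σ₀ * σ) fun τ => hle.trans (hmin τ)
    exact hσ (mul_eq_left.1 this)
  obtain ⟨α, hα⟩ := exists_potential_s19
    (fun i j => A (r i) (c (σ₀ j)) - A (r i) (c (σ₀ i))) (fun i => sub_self _) hpos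
  let e : Fin p ≃ Fin p := Equiv.ofBijective r (Finite.injective_iff_bijective.1 hr)
  have he : ∀ a, r (e.symm a) = a := e.apply_symm_apply
  refine ⟨fun a => A a (c (σ₀ (e.symm a))) + α (e.symm a), fun a => c (σ₀ (e.symm a)),
    fun a b hab => ?_⟩
  have := hα (e.symm b) (e.symm a) fun h => hab (e.symm.injective h)
  simp only [he] at this
  linarith

lemma tropRank_eq_iff {p n : ℕ} (hp : p ≠ 0) (A : Fin p → Fin n → ℝ) :
    tropRank p n A = p ↔ ∃ x g, IsStrictlyTight A x g := by
  have hub : ∀ k ∈ {k : ℕ | ∃ r : Fin k → Fin p, ∃ c : Fin k → Fin n,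
      Function.Injective r ∧ Function.Injective c ∧
      TropNonsingular (fun i j => A (r i) (c j))}, k ≤ p := by
    rintro k ⟨r, -, hr, -⟩
    simpa using Fintype.card_le_of_injective r hr
  constructor
  · intro h
    have hmem := Nat.sSup_mem (Set.nonempty_iff_ne_empty.2 fun he => hp ?_) ⟨p, hub⟩
    · change tropRank p n A ∈ _ at hmem
      rw [h] at hmem
      obtain ⟨r, c, hr, -, hns⟩ := hmem
      exact exists_isStrictlyTight_of_tropNonsingular hr hns
    · rw [← h, tropRank, he]
      simp
  · rintro ⟨x, g, h⟩
    refine le_antisymm (csSup_le' hub) (le_csSup ⟨p, hub⟩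
      ⟨id, g, Function.injective_id, fun a b hab => ?_, tropNonsingular_of_isStrictlyTight h⟩)
    by_contra hne
    have h1 := h a b (Ne.symm hne)
    have h2 := h b a hne
    rw [hab] at h1
    linarith

/-- The lift of a chart point to homogeneous coordinates with first entry `0`. -/
def homogenize {p : ℕ} (y : Fin p → ℝ) : Fin (p + 1) → ℝ := Fin.cons 0 y

lemma mem_tconv_succ {p n : ℕ} {A : Fin (p + 1) → Fin n → ℝ} {y : Fin p → ℝ} :
    y ∈ tconv (p + 1) A ↔ ∃ α : Fin n → ℝ, ∀ a,
      homogenize y a = (⨅ j, (α j + A a j)) - ⨅ j, (α j + A 0 j) := by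
  refine exists_congr fun α => ⟨fun h a => ?_, fun h k => ?_⟩
  · refine Fin.cases ?_ (fun k => ?_) a
    · simp [homogenize]
    · exact h k
  · exact h k.succ

lemma continuous_homogenize {p : ℕ} (a : Fin (p + 1)) :
    Continuous fun y : Fin p → ℝ => homogenize y a := by
  refine Fin.cases ?_ (fun k => ?_) a
  · exact continuous_const
  · exact continuous_apply k

lemma volume_tconv_pos {p n : ℕ} {A : Fin (p + 1) → Fin n → ℝ} {x : Fin (p + 1) → ℝ}
    {g : Fin (p + 1) → Fin n} (h : IsStrictlyTight A x g) :
    0 < volume (tconv (p + 1) A : Set (Fin p → ℝ)) := by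
  set U : Set (Fin p → ℝ) := {y | IsStrictlyTight A (homogenize y) g} with hU
  have hUopen : IsOpen U := by
    have : U = ⋂ a, ⋂ b, ⋂ (_ : b ≠ a),
        {y | homogenize y b - A b (g a) < homogenize y a - A a (g a)} := by
      ext y
      simp [hU, IsStrictlyTight]
    rw [this]
    refine isOpen_iInter_of_finite fun a => isOpen_iInter_of_finite
      fun b => isOpen_iInter_of_finite fun _ => ?_
    exact isOpen_lt ((continuous_homogenize b).sub continuous_const)
      ((continuous_homogenize a).sub continuous_const)
  have hUne : U.Nonempty := by
    refine ⟨fun k => x k.succ - x 0, fun a b hab => ?_⟩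
    have hx : ∀ a, homogenize (fun k : Fin p => x k.succ - x 0) a = x a - x 0 := fun a => by
      refine Fin.cases ?_ (fun k => ?_) a <;> simp [homogenize]
    rw [hx, hx]
    linarith [h a b hab]
  refine (hUopen.measure_pos volume hUne).trans_le (measure_mono fun y hy => ?_)
  have : Nonempty (Fin n) := ⟨g 0⟩
  let α : Fin n → ℝ := fun j => ⨆ a, (homogenize y a - A a j)
  have hval : ∀ a, ⨅ j, (α j + A a j) = homogenize y a := by
    intro a
    refine le_antisymm ?_ (le_ciInf fun j => ?_)
    · refine (ciInf_le (Finite.bddBelow_range _) (g a)).trans ?_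
      have : α (g a) ≤ homogenize y a - A a (g a) := ciSup_le fun b => by
        by_cases hb : b = a
        · rw [hb]
        · exact (hy a b hb).le
      linarith
    · have := le_ciSup (Finite.bddAbove_range fun a => homogenize y a - A a j) a
      change homogenize y a ≤ (⨆ a, (homogenize y a - A a j)) + A a j
      linarith
  refine mem_tconv_succ.2 ⟨α, fun a => ?_⟩
  rw [hval, hval]
  simp [homogenize]

lemma volume_homogenize_sub_eq {p : ℕ} {a b : Fin (p + 1)} (hab : a ≠ b) (c : ℝ) :
    volume {y : Fin p → ℝ | homogenize y a - homogenize y b = c} = 0 := by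
  let L : (Fin p → ℝ) →ₗ[ℝ] ℝ :=
    { toFun := fun y => homogenize y a - homogenize y b
      map_add' := fun y z => by
        have h : ∀ a, homogenize (y + z) a = homogenize y a + homogenize z a := fun a => by
          refine Fin.cases ?_ (fun k => ?_) a <;> simp [homogenize]
        rw [h, h]
        ring
      map_smul' := fun t y => by
        have h : ∀ a, homogenize (t • y) a = t * homogenize y a := fun a => by
          refine Fin.cases ?_ (fun k => ?_) a <;> simp [homogenize]
        rw [h, h]
        simp [mul_sub] }
  let s : AffineSubspace ℝ (Fin p → ℝ) := (AffineSubspace.mk' c ⊥).comap L.toAffineMap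
  have hs : (s : Set (Fin p → ℝ)) = {y | homogenize y a - homogenize y b = c} := by
    ext y
    simp [s, AffineSubspace.mem_mk', sub_eq_zero, L]
  rw [← hs]
  refine Measure.addHaar_affineSubspace _ _ fun htop => ?_
  have hall : ∀ y : Fin p → ℝ, homogenize y a - homogenize y b = c := fun y => by
    change y ∈ {y : Fin p → ℝ | homogenize y a - homogenize y b = c}
    rw [← hs, htop]
    trivial
  have h0 := hall 0
  have h1 := hall fun k => if k.succ = a then 1 else if k.succ = b then -1 else 0
  have h2 : ∀ a, homogenize (0 : Fin p → ℝ) a = 0 := fun a => by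
    refine Fin.cases ?_ (fun k => ?_) a <;> simp [homogenize]
  rw [h2, h2] at h0
  revert hab h1
  refine Fin.cases ?_ (fun k => ?_) a <;> refine Fin.cases ?_ (fun l => ?_) b <;>
    simp [homogenize, ← h0, Fin.succ_ne_zero, eq_comm]
  intro h
  simp [h]
  norm_num

lemma exists_isStrictlyTight_of_volume_pos {p n : ℕ} (hn : 1 ≤ n) {A : Fin (p + 1) → Fin n → ℝ}
    (h : 0 < volume (tconv (p + 1) A : Set (Fin p → ℝ))) : ∃ x g, IsStrictlyTight A x g := by
  set B : Set (Fin p → ℝ) := ⋃ a, ⋃ b, ⋃ (_ : a ≠ b), ⋃ j,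
    {y | homogenize y a - homogenize y b = A a j - A b j} with hB
  have hB0 : volume B = 0 := by
    simp only [hB, measure_iUnion_null_iff]
    exact fun a b hab j => volume_homogenize_sub_eq hab _
  obtain ⟨y, hy, hyB⟩ : ∃ y ∈ (tconv (p + 1) A : Set (Fin p → ℝ)), y ∉ B := by
    by_contra! hc
    exact h.ne' (measure_mono_null hc hB0)
  obtain ⟨α, hα⟩ := mem_tconv_succ.1 hy
  have : Nonempty (Fin n) := ⟨⟨0, hn⟩⟩
  choose g hg using fun a => exists_eq_ciInf_of_finite (f := fun j => α j + A a j)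
  refine ⟨fun a => ⨅ j, (α j + A a j), g, fun a b hab => ?_⟩
  have hle : ⨅ j, (α j + A b j) ≤ α (g a) + A b (g a) :=
    ciInf_le (Finite.bddBelow_range _) (g a)
  have hne : ⨅ j, (α j + A b j) ≠ α (g a) + A b (g a) := fun he => by
    refine hyB ?_
    simp only [hB, Set.mem_iUnion]
    refine ⟨a, b, hab.symm, g a, ?_⟩
    change _ = _
    rw [hα a, hα b, he, ← hg a]
    ring
  have hlt := lt_of_le_of_ne hle hne
  have hga := hg a
  dsimp only at hga ⊢
  linarith

/-- A tropical polytope with rational generators has strictly positive Lebesgue measure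
in `ℝ^(m-1)` if and only if the generating matrix has maximal tropical rank `m`. -/
theorem stmt19 (m n : ℕ) (hm : 2 ≤ m) (hn : 1 ≤ n) (A : Fin m → Fin n → ℚ) :
    0 < volume (tconv m (fun i j => (A i j : ℝ))) ↔
      tropRank m n (fun i j => (A i j : ℝ)) = m := by
  obtain ⟨p, rfl⟩ : ∃ p, m = p + 1 := ⟨m - 1, by omega⟩
  rw [tropRank_eq_iff p.succ_ne_zero]
  exact ⟨exists_isStrictlyTight_of_volume_pos hn, fun ⟨_, _, h⟩ => volume_tconv_pos h⟩
end
end
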